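/- arXiv:2506.03464 — 6 statements merged into one kernel-verified Lean document; each statement's English description precedes it below -/
import Mathlib

section
/- Consider an n-player game with linear utilities and, for each player i, a deterministic online algorithm R_i mapping each finite sequence of utility vectors in ℝ^{d_i} to a point of X_i. Define the original dynamics by x̂^t_i := R_i(v^1_i,…,v^{t−1}_i) where v^k_i := Σ_{j≠i} M_{ij} x̂^k_j, and define the A2L dynamics recursively by x^t_i := R_i(u^1_i,…,u^{t−1}_i), x̄^t_i := (1/t)Σ_{k=1}^t x^k_i, ū^t_i := Σ_{j≠i} M_{ij} x̄^t_j, and u^t_i := t·ū^t_i − Σ_{k=1}^{t−1} u^k_i. Then for every player i and every t ≥ 1, x^t_i = x̂^t_i and x̄^t_i = (1/t)·Σ_{k=1}^t x̂^k_i; i.e., the last iterate of the A2L dynamics equals the running average of the original dynamics. -/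
open Finset

/-- in a game with linear utilities, if every player runs the A2L reduction on top
of a deterministic online algorithm `R_i`, then the produced internal iterates coincide with the
iterates of the original dynamics, and the played (last) iterate of the A2L dynamics equals the
running average of the original dynamics. -/
theorem stmt1 (n : ℕ) (hn : 1 ≤ n)
    (d : Fin n → ℕ)
    (X : ∀ i : Fin n, Set (Fin (d i) → ℝ))
    (hXclosed : ∀ i, IsClosed (X i)) (hXconvex : ∀ i, Convex ℝ (X i))
    (M : ∀ i j : Fin n, Matrix (Fin (d i)) (Fin (d j)) ℝ)
    -- deterministic online algorithms, mapping finite sequences of utility vectors to points of `X i`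
    (R : ∀ i : Fin n, ∀ s : ℕ, (Fin s → (Fin (d i) → ℝ)) → (Fin (d i) → ℝ))
    (hR : ∀ i s v, R i s v ∈ X i)
    -- the original dynamics
    (xhat : ℕ → ∀ j : Fin n, Fin (d j) → ℝ)
    (vhat : ℕ → ∀ j : Fin n, Fin (d j) → ℝ)
    (hvhat : ∀ k i a, vhat k i a = ∑ j ∈ Finset.univ.erase i, ∑ b, M i j a b * xhat k j b)
    (hxhat : ∀ t, 1 ≤ t → ∀ i, xhat t i = R i (t - 1) (fun k => vhat (k.1 + 1) i))
    -- the A2L dynamics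
    (x xbar ubar u : ℕ → ∀ j : Fin n, Fin (d j) → ℝ)
    (hx : ∀ t, 1 ≤ t → ∀ i, x t i = R i (t - 1) (fun k => u (k.1 + 1) i))
    (hxbar : ∀ t, 1 ≤ t → ∀ i a, xbar t i a = (1 / (t : ℝ)) * ∑ k ∈ Finset.Icc 1 t, x k i a)
    (hubar : ∀ t, 1 ≤ t → ∀ i a,
      ubar t i a = ∑ j ∈ Finset.univ.erase i, ∑ b, M i j a b * xbar t j b)
    (hu : ∀ t, 1 ≤ t → ∀ i a,
      u t i a = (t : ℝ) * ubar t i a - ∑ k ∈ Finset.Icc 1 (t - 1), u k i a) :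
    ∀ i : Fin n, ∀ t, 1 ≤ t →
      x t i = xhat t i ∧
      ∀ a, xbar t i a = (1 / (t : ℝ)) * ∑ k ∈ Finset.Icc 1 t, xhat k i a := by
  have hsum : ∀ t i a, ∑ k ∈ Finset.Icc 1 t, u k i a =
      ∑ j ∈ Finset.univ.erase i, ∑ b, M i j a b * ∑ k ∈ Finset.Icc 1 t, x k j b := by
    intro t i a
    rcases t with _ | s
    · simp
    · have hs : ((s + 1 : ℕ) : ℝ) ≠ 0 := by positivity
      rw [Finset.sum_Icc_succ_top (by omega) (fun k => u k i a), hu (s + 1) (by omega),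
        Nat.add_sub_cancel, add_sub_cancel, hubar (s + 1) (by omega), Finset.mul_sum]
      refine Finset.sum_congr rfl fun j _ => ?_
      rw [Finset.mul_sum]
      refine Finset.sum_congr rfl fun b _ => ?_
      rw [hxbar (s + 1) (by omega)]
      field_simp
  have hux : ∀ s i a, u (s + 1) i a =
      ∑ j ∈ Finset.univ.erase i, ∑ b, M i j a b * x (s + 1) j b := by
    intro s i a
    have h := hsum (s + 1) i a
    simp only [Finset.sum_Icc_succ_top (Nat.le_add_left 1 s), mul_add,
      Finset.sum_add_distrib] at h
    linarith [hsum s i a]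
  have hxx : ∀ t, 1 ≤ t → ∀ i, x t i = xhat t i := by
    intro t
    induction t using Nat.strong_induction_on with
    | _ t ih =>
      intro ht i
      rw [hx t ht, hxhat t ht]
      congr 1
      funext k a
      rw [hux, hvhat]
      have hk : k.1 + 1 < t := by omega
      simp only [ih (k.1 + 1) hk (by omega)]
  intro i t ht
  refine ⟨hxx t ht i, fun a => ?_⟩
  rw [hxbar t ht]
  congr 1
  refine Finset.sum_congr rfl fun k hk => ?_
  rw [hxx k (Finset.mem_Icc.mp hk).1]
end

section
/- Consider an n-player game with linear utilities, deterministic online algorithms R_i mapping finite sequences of utility vectors in ℝ^{d_i} to points of X_i, and positive weights α_1, α_2, … > 0 agreed by all players. Define the original dynamics by x̂^t_i := R_i(v^1_i,…,v^{t−1}_i) where v^k_i := Σ_{j≠i} M_{ij} x̂^k_j, and define the weighted A2L dynamics recursively by x^t_i := R_i(u^1_i,…,u^{t−1}_i), x̄^t_i := (Σ_{k=1}^t α_k x^k_i)/(Σ_{k=1}^t α_k), ū^t_i := Σ_{j≠i} M_{ij} x̄^t_j, and u^t_i := ((Σ_{k=1}^t α_k)·ū^t_i − Σ_{k=1}^{t−1}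 α_k u^k_i)/α_t. Then for every player i and every t ≥ 1, x^t_i = x̂^t_i and x̄^t_i = (Σ_{k=1}^t α_k x̂^k_i)/(Σ_{k=1}^t α_k). -/
open Finset

/-- weighted version of the A2L reduction.  In a game with linear utilities,
if every player runs the weighted A2L reduction (with common positive weights `α`) on top of a
deterministic online algorithm `R_i`, the internal iterates coincide with the original dynamics,
and the played (last) iterate equals the weighted running average of the original dynamics. -/
theorem stmt2 (n : ℕ) (hn : 1 ≤ n)
    (d : Fin n → ℕ)
    (X : ∀ i : Fin n, Set (Fin (d i) → ℝ))
    (hXclosed : ∀ i, IsClosed (X i)) (hXconvex : ∀ i, Convex ℝ (X i))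
    (M : ∀ i j : Fin n, Matrix (Fin (d i)) (Fin (d j)) ℝ)
    (α : ℕ → ℝ) (hα : ∀ t, 1 ≤ t → 0 < α t)
    -- deterministic online algorithms, mapping finite sequences of utility vectors to points of `X i`
    (R : ∀ i : Fin n, ∀ s : ℕ, (Fin s → (Fin (d i) → ℝ)) → (Fin (d i) → ℝ))
    (hR : ∀ i s v, R i s v ∈ X i)
    -- the original dynamics
    (xhat : ℕ → ∀ j : Fin n, Fin (d j) → ℝ)
    (vhat : ℕ → ∀ j : Fin n, Fin (d j) → ℝ)
    (hvhat : ∀ k i a, vhat k i a = ∑ j ∈ Finset.univ.erase i, ∑ b, M i j a b * xhat k j b)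
    (hxhat : ∀ t, 1 ≤ t → ∀ i, xhat t i = R i (t - 1) (fun k => vhat (k.1 + 1) i))
    -- the weighted A2L dynamics
    (x xbar ubar u : ℕ → ∀ j : Fin n, Fin (d j) → ℝ)
    (hx : ∀ t, 1 ≤ t → ∀ i, x t i = R i (t - 1) (fun k => u (k.1 + 1) i))
    (hxbar : ∀ t, 1 ≤ t → ∀ i a,
      xbar t i a = (∑ k ∈ Finset.Icc 1 t, α k * x k i a) / (∑ k ∈ Finset.Icc 1 t, α k))
    (hubar : ∀ t, 1 ≤ t → ∀ i a,
      ubar t i a = ∑ j ∈ Finset.univ.erase i, ∑ b, M i j a b * xbar t j b)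
    (hu : ∀ t, 1 ≤ t → ∀ i a,
      u t i a = ((∑ k ∈ Finset.Icc 1 t, α k) * ubar t i a
        - ∑ k ∈ Finset.Icc 1 (t - 1), α k * u k i a) / α t) :
    ∀ i : Fin n, ∀ t, 1 ≤ t →
      x t i = xhat t i ∧
      ∀ a, xbar t i a =
        (∑ k ∈ Finset.Icc 1 t, α k * xhat k i a) / (∑ k ∈ Finset.Icc 1 t, α k) := by
  have key : ∀ t, 1 ≤ t → (∀ i, x t i = xhat t i) ∧ ∀ i, u t i = vhat t i := by
    intro t
    induction t using Nat.strong_induction_on with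
    | _ t ih =>
      intro ht
      have hxt : ∀ i, x t i = xhat t i := by
        intro i
        rw [hx t ht, hxhat t ht]
        congr 1
        funext k
        exact (ih (k.1 + 1) (by omega) (by omega)).2 i
      refine ⟨hxt, fun i => funext fun a => ?_⟩
      have hx_le : ∀ k ∈ Finset.Icc 1 t, ∀ j, x k j = xhat k j := by
        intro k hk j
        rw [Finset.mem_Icc] at hk
        rcases hk.2.lt_or_eq with h | rfl
        · exact (ih k h hk.1).1 j
        · exact hxt j
      have hS : 0 < ∑ k ∈ Finset.Icc 1 t, α k :=
        Finset.sum_pos (fun k hk => hα k (Finset.mem_Icc.1 hk).1) ⟨1, by simpa using ht⟩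
      have hscaled : (∑ k ∈ Finset.Icc 1 t, α k) * ubar t i a
          = ∑ k ∈ Finset.Icc 1 t, α k * vhat k i a := by
        have hxbar_mul : ∀ j b, (∑ k ∈ Finset.Icc 1 t, α k) * xbar t j b
            = ∑ k ∈ Finset.Icc 1 t, α k * xhat k j b := by
          intro j b
          rw [hxbar t ht, mul_div_cancel₀ _ hS.ne']
          exact Finset.sum_congr rfl fun k hk => by rw [hx_le k hk]
        simp_rw [hubar t ht, hvhat, Finset.mul_sum]
        rw [Finset.sum_comm]
        refine Finset.sum_congr rfl fun j _ => ?_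
        rw [Finset.sum_comm]
        refine Finset.sum_congr rfl fun b _ => ?_
        rw [mul_left_comm, hxbar_mul, Finset.mul_sum]
        exact Finset.sum_congr rfl fun k _ => mul_left_comm _ _ _
      have hprev : ∑ k ∈ Finset.Icc 1 (t - 1), α k * u k i a
          = ∑ k ∈ Finset.Icc 1 (t - 1), α k * vhat k i a := by
        refine Finset.sum_congr rfl fun k hk => ?_
        rw [Finset.mem_Icc] at hk
        rw [(ih k (by omega) hk.1).2]
      have hsplit : ∑ k ∈ Finset.Icc 1 t, α k * vhat k i a
          = ∑ k ∈ Finset.Icc 1 (t - 1), α k * vhat k i a + α t * vhat t i a := by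
        obtain ⟨s, rfl⟩ : ∃ s, t = s + 1 := ⟨t - 1, by omega⟩
        exact Finset.sum_Icc_succ_top (by omega) _
      rw [hu t ht, hscaled, hprev, hsplit, add_sub_cancel_left,
        mul_div_cancel_left₀ _ (hα t ht).ne']
  intro i t ht
  refine ⟨(key t ht).1 i, fun a => ?_⟩
  rw [hxbar t ht]
  congr 1
  exact Finset.sum_congr rfl fun k hk => by rw [(key k (Finset.mem_Icc.1 hk).1).1]
end

section
/- Let u^1,…,u^T ∈ ℝ^d be an arbitrary sequence of utility vectors (with the convention u^0 = 0) and let x^1,…,x^T be the iterates of OMWU with step size η > 0 on this sequence (with x^0 := x^1). Then the regret satisfies the RVU bound: max_{x ∈ Δ^d} Σ_{t=1}^T ⟨u^t, x − x^t⟩ ≤ (log d)/η + η·Σ_{t=1}^T ‖u^t − u^{t−1}‖_∞² − (1/(4η))·Σ_{t=1}^T ‖x^t − x^{t−1}‖_1². -/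
open Finset

/-- The softmax distribution with logits `v`. -/
noncomputable def softmax {ι : Type*} [Fintype ι] (v : ι → ℝ) (a : ι) : ℝ :=
  Real.exp (v a) / ∑ b, Real.exp (v b)

/-- The log-sum-exp function, the convex potential whose gradient is `softmax`. -/
noncomputable def logSumExp {ι : Type*} [Fintype ι] (v : ι → ℝ) : ℝ :=
  Real.log (∑ b, Real.exp (v b))

/-- A rational lower bound for the logarithm, tangent to third order at `1`. -/
lemma rational_le_log {r : ℝ} (hr : 0 < r) :
    (5 * r ^ 2 - 4 * r - 1) / (2 * r ^ 2 + 4 * r) ≤ Real.log r := by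
  let f : ℝ → ℝ := fun r => Real.log r - (5 * r ^ 2 - 4 * r - 1) / (2 * r ^ 2 + 4 * r)
  have hf : ∀ s : ℝ, 0 < s → HasDerivAt f ((s - 1) ^ 3 / (s ^ 2 * (s + 2) ^ 2)) s := by
    intro s hs
    have hne : 2 * s ^ 2 + 4 * s ≠ 0 := by positivity
    have hnum : HasDerivAt (fun r : ℝ => 5 * r ^ 2 - 4 * r - 1) (10 * s - 4) s := by
      refine ((((hasDerivAt_pow 2 s).const_mul 5).sub
        ((hasDerivAt_id s).const_mul 4)).sub_const 1).congr_deriv ?_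
      norm_num
      ring
    have hden : HasDerivAt (fun r : ℝ => 2 * r ^ 2 + 4 * r) (4 * s + 4) s := by
      refine (((hasDerivAt_pow 2 s).const_mul 2).add
        ((hasDerivAt_id s).const_mul 4)).congr_deriv ?_
      norm_num
      ring
    refine ((Real.hasDerivAt_log hs.ne').sub (hnum.div hden hne)).congr_deriv ?_
    have h2 : s + 2 ≠ 0 := by positivity
    have hfac : 2 * s ^ 2 + 4 * s = 2 * s * (s + 2) := by ring
    rw [hfac]
    field_simp
    ring
  have h1 : f 1 = 0 := by norm_num [f]
  suffices 0 ≤ f r by simpa [f] using this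
  rw [← h1]
  rcases le_total r 1 with hle | hle
  · refine antitoneOn_of_deriv_nonpos (convex_Icc r 1) (fun s hs => ?_) (fun s hs => ?_)
      (fun s hs => ?_) (Set.left_mem_Icc.2 hle) (Set.right_mem_Icc.2 hle) hle
    · exact (hf s (hr.trans_le hs.1)).continuousAt.continuousWithinAt
    · rw [interior_Icc] at hs
      exact (hf s (hr.trans hs.1)).differentiableAt.differentiableWithinAt
    · rw [interior_Icc] at hs
      rw [(hf s (hr.trans hs.1)).deriv]
      have : (s - 1) ^ 3 ≤ 0 := Odd.pow_nonpos (by decide) (by linarith [hs.2])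
      exact div_nonpos_of_nonpos_of_nonneg this (by positivity)
  · refine monotoneOn_of_deriv_nonneg (convex_Icc 1 r) (fun s hs => ?_) (fun s hs => ?_)
      (fun s hs => ?_) (Set.left_mem_Icc.2 hle) (Set.right_mem_Icc.2 hle) hle
    · exact (hf s (one_pos.trans_le hs.1)).continuousAt.continuousWithinAt
    · rw [interior_Icc] at hs
      exact (hf s (one_pos.trans hs.1)).differentiableAt.differentiableWithinAt
    · rw [interior_Icc] at hs
      rw [(hf s (one_pos.trans hs.1)).deriv]
      have : 0 ≤ s - 1 := by linarith [hs.1]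
      have : 0 < s := one_pos.trans hs.1
      positivity

lemma sq_sub_div_le_mul_log {p q : ℝ} (hp : 0 < p) (hq : 0 < q) :
    (p - q) ^ 2 / ((2 * p + 4 * q) / 3) ≤ p * (Real.log p - Real.log q) - p + q := by
  have h := mul_le_mul_of_nonneg_left (rational_le_log (div_pos hp hq)) hp.le
  rw [Real.log_div hp.ne' hq.ne'] at h
  have key : (p - q) ^ 2 / ((2 * p + 4 * q) / 3) + p - q =
      p * ((5 * (p / q) ^ 2 - 4 * (p / q) - 1) / (2 * (p / q) ^ 2 + 4 * (p / q))) := by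
    have h1 : 2 * (p / q) ^ 2 + 4 * (p / q) = 2 * p * (p + 2 * q) / q ^ 2 := by
      field_simp
      ring
    have h2 : 2 * p + 4 * q = 2 * (p + 2 * q) := by ring
    have h3 : p + 2 * q ≠ 0 := by positivity
    rw [h1, h2]
    field_simp
    ring
  linarith

/-- Pinsker's inequality for positive probability vectors. -/
lemma pinsker_of_pos {ι : Type*} [Fintype ι] {p q : ι → ℝ} (hp : ∀ a, 0 < p a)
    (hq : ∀ a, 0 < q a) (hp1 : ∑ a, p a = 1) (hq1 : ∑ a, q a = 1) :
    (∑ a, |p a - q a|) ^ 2 / 2 ≤ ∑ a, p a * (Real.log (p a) - Real.log (q a)) := by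
  have hw : ∀ a ∈ univ, 0 < (2 * p a + 4 * q a) / 3 := fun a _ => by
    have := hp a
    have := hq a
    positivity
  have hcs := Finset.sq_sum_div_le_sum_sq_div univ (fun a => |p a - q a|) hw
  have hsum : ∑ a, (2 * p a + 4 * q a) / 3 = 2 := by
    rw [← Finset.sum_div, Finset.sum_add_distrib, ← Finset.mul_sum, ← Finset.mul_sum, hp1, hq1]
    norm_num
  have hle := Finset.sum_le_sum fun a (_ : a ∈ univ) => sq_sub_div_le_mul_log (hp a) (hq a)
  rw [Finset.sum_add_distrib, Finset.sum_sub_distrib, hp1, hq1] at hle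
  simp only [sq_abs, hsum] at hcs
  linarith

lemma sum_mul_softmax_sub_le {ι : Type*} [Fintype ι] {v w : ι → ℝ} {C : ℝ}
    (hC : ∀ a, |v a - w a| ≤ C) :
    ∑ a, (v a - w a) * (softmax v a - softmax w a) ≤
      C * ∑ a, |softmax v a - softmax w a| := by
  rw [Finset.mul_sum]
  refine Finset.sum_le_sum fun a _ => (le_abs_self _).trans ?_
  rw [abs_mul]
  exact mul_le_mul_of_nonneg_right (hC a) (abs_nonneg _)

lemma sq_sum_abs_sub_le {ι : Type*} [Fintype ι] (p q r : ι → ℝ) :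
    (∑ a, |p a - r a|) ^ 2 ≤ 2 * (∑ a, |p a - q a|) ^ 2 + 2 * (∑ a, |q a - r a|) ^ 2 := by
  have h : ∑ a, |p a - r a| ≤ ∑ a, |p a - q a| + ∑ a, |q a - r a| := by
    rw [← Finset.sum_add_distrib]
    exact Finset.sum_le_sum fun a _ => abs_sub_le _ _ _
  have h0 : 0 ≤ ∑ a, |p a - r a| := Finset.sum_nonneg fun a _ => abs_nonneg _
  nlinarith [sq_nonneg (∑ a, |p a - q a| - ∑ a, |q a - r a|), pow_le_pow_left₀ h0 h 2]

section Softmax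

variable {ι : Type*} [Fintype ι] [Nonempty ι]

lemma sum_exp_pos (v : ι → ℝ) : 0 < ∑ b, Real.exp (v b) :=
  Finset.sum_pos (fun _ _ => Real.exp_pos _) univ_nonempty

lemma softmax_pos (v : ι → ℝ) (a : ι) : 0 < softmax v a :=
  div_pos (Real.exp_pos _) (sum_exp_pos v)

lemma sum_softmax (v : ι → ℝ) : ∑ a, softmax v a = 1 := by
  simp only [softmax]
  rw [← Finset.sum_div, div_self (sum_exp_pos v).ne']

lemma log_softmax (v : ι → ℝ) (a : ι) : Real.log (softmax v a) = v a - logSumExp v := by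
  rw [softmax, Real.log_div (Real.exp_pos _).ne' (sum_exp_pos v).ne', Real.log_exp, logSumExp]

lemma le_logSumExp (v : ι → ℝ) (a : ι) : v a ≤ logSumExp v := by
  rw [logSumExp, Real.le_log_iff_exp_le (sum_exp_pos v)]
  exact Finset.single_le_sum (f := fun b => Real.exp (v b)) (fun _ _ => (Real.exp_pos _).le)
    (mem_univ a)

/-- Strong convexity of `logSumExp`'s conjugate, expressed through softmax distributions. -/
lemma sq_softmax_sub_le (v w : ι → ℝ) :
    (∑ a, |softmax v a - softmax w a|) ^ 2 / 2 ≤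
      ∑ a, (v a - w a) * softmax v a - logSumExp v + logSumExp w := by
  refine (pinsker_of_pos (softmax_pos v) (softmax_pos w) (sum_softmax v) (sum_softmax w)).trans_eq
    ?_
  have h : ∀ a, softmax v a * (Real.log (softmax v a) - Real.log (softmax w a)) =
      (v a - w a) * softmax v a - softmax v a * (logSumExp v - logSumExp w) := fun a => by
    rw [log_softmax, log_softmax]
    ring
  rw [Finset.sum_congr rfl fun a _ => h a, Finset.sum_sub_distrib, ← Finset.sum_mul, sum_softmax]
  ring

/-- Softmax is `1`-Lipschitz from the sup-norm to the `ℓ1`-norm. -/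
lemma sum_abs_softmax_sub_le {v w : ι → ℝ} {C : ℝ} (hC0 : 0 ≤ C)
    (hC : ∀ a, |v a - w a| ≤ C) :
    ∑ a, |softmax v a - softmax w a| ≤ C := by
  have h1 := sq_softmax_sub_le v w
  have h2 := sq_softmax_sub_le w v
  have h3 := sum_mul_softmax_sub_le hC
  have h4 : ∑ a, (v a - w a) * (softmax v a - softmax w a) =
      ∑ a, (v a - w a) * softmax v a + ∑ a, (w a - v a) * softmax w a := by
    rw [← Finset.sum_add_distrib]
    exact Finset.sum_congr rfl fun a _ => by ring
  simp only [abs_sub_comm (softmax w _)] at h2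
  by_contra! hlt
  nlinarith

/-- One step of the optimistic update: `v` are the logits before the step, `m` the optimistic
logits and `w` the logits after the step. -/
lemma logSumExp_sub_le (v m w : ι → ℝ) {C : ℝ} (hC0 : 0 ≤ C) (hC : ∀ a, |w a - m a| ≤ C) :
    logSumExp w - logSumExp v - ∑ a, (w a - v a) * softmax m a ≤
      C ^ 2 - (∑ a, |softmax w a - softmax m a|) ^ 2 / 2
        - (∑ a, |softmax m a - softmax v a|) ^ 2 / 2 := by
  have h1 := sq_softmax_sub_le w m
  have h2 := sq_softmax_sub_le m v
  have h3 := sum_mul_softmax_sub_le hC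
  have h4 := mul_le_mul_of_nonneg_left (sum_abs_softmax_sub_le hC0 hC) hC0
  have h5 : ∑ a, (w a - v a) * softmax m a = ∑ a, (w a - m a) * softmax w a
      + ∑ a, (m a - v a) * softmax m a - ∑ a, (w a - m a) * (softmax w a - softmax m a) := by
    rw [← Finset.sum_add_distrib, ← Finset.sum_sub_distrib]
    exact Finset.sum_congr rfl fun a _ => by ring
  linarith

/-- The potential along the optimistic iterates, with the distance between the current softmax
and its optimistic prediction retained for telescoping. -/
lemma logSumExp_potential_le {T : ℕ} {η : ℝ} (hη : 0 < η) {u x : ℕ → ι → ℝ} (hx0 : x 0 = x 1)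
    (hx : ∀ t, 1 ≤ t → t ≤ T →
      x t = softmax fun a => η * ((∑ k ∈ Finset.range t, u k a) + u (t - 1) a))
    {n : ℕ} (hn : 1 ≤ n) (hnT : n ≤ T) :
    logSumExp (fun a => η * ∑ k ∈ Finset.range (n + 1), u k a)
        - logSumExp (fun a => η * ∑ k ∈ Finset.range 1, u k a)
        - η * ∑ t ∈ Finset.Icc 1 n, ∑ a, u t a * x t a ≤
      η ^ 2 * ∑ t ∈ Finset.Icc 1 n, ‖u t - u (t - 1)‖ ^ 2
        - (∑ t ∈ Finset.Icc 1 n, (∑ a, |x t a - x (t - 1) a|) ^ 2) / 4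
        - (∑ a, |softmax (fun a => η * ∑ k ∈ Finset.range (n + 1), u k a) a - x n a|) ^ 2 / 2 := by
  have step : ∀ t, 1 ≤ t → t ≤ T →
      logSumExp (fun a => η * ∑ k ∈ Finset.range (t + 1), u k a)
        - logSumExp (fun a => η * ∑ k ∈ Finset.range t, u k a) - η * ∑ a, u t a * x t a ≤
      η ^ 2 * ‖u t - u (t - 1)‖ ^ 2
        - (∑ a, |softmax (fun a => η * ∑ k ∈ Finset.range (t + 1), u k a) a - x t a|) ^ 2 / 2
        - (∑ a, |x t a - softmax (fun a => η * ∑ k ∈ Finset.range t, u k a) a|) ^ 2 / 2 := by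
    intro t h1 hT
    have h := logSumExp_sub_le (fun a => η * ∑ k ∈ Finset.range t, u k a)
      (fun a => η * ((∑ k ∈ Finset.range t, u k a) + u (t - 1) a))
      (fun a => η * ∑ k ∈ Finset.range (t + 1), u k a)
      (C := η * ‖u t - u (t - 1)‖) (by positivity) (fun a => by
        rw [Finset.sum_range_succ, ← mul_sub, abs_mul, abs_of_pos hη, add_sub_add_left_eq_sub]
        exact mul_le_mul_of_nonneg_left (norm_le_pi_norm (u t - u (t - 1)) a) hη.le)
    rw [← hx t h1 hT, mul_pow] at h
    convert h using 2
    rw [Finset.mul_sum]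
    refine Finset.sum_congr rfl fun a _ => ?_
    rw [Finset.sum_range_succ]
    ring
  induction n, hn using Nat.le_induction with
  | base =>
    have h := step 1 le_rfl hnT
    have h0 := sq_nonneg
      (∑ a, |x 1 a - softmax (fun a => η * ∑ k ∈ Finset.range 1, u k a) a|)
    simp only [Finset.Icc_self, Finset.sum_singleton, Nat.sub_self, hx0, sub_self, abs_zero,
      Finset.sum_const_zero] at h ⊢
    linarith
  | succ n hn ih =>
    have h := step (n + 1) (by omega) hnT
    have ih := ih (by omega)
    have htri := sq_sum_abs_sub_le (x (n + 1))
      (softmax fun a => η * ∑ k ∈ Finset.range (n + 1), u k a) (x n)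
    simp only [Finset.sum_Icc_succ_top (show 1 ≤ n + 1 by omega), Nat.add_sub_cancel, mul_add]
      at h ⊢
    linarith

end Softmax

/-- the RVU (regret bounded by variation in utilities) property of OMWU.
`x t` are the OMWU iterates (closed form, with `u 0 = 0` and `x 0 := x 1`); the `‖·‖` on
`Fin d → ℝ` is the sup-norm, and the ℓ1-norm is written explicitly. -/
theorem stmt3 (d T : ℕ) (hd : 1 ≤ d) (hT : 1 ≤ T)
    (η : ℝ) (hη : 0 < η)
    (u : ℕ → Fin d → ℝ) (hu0 : u 0 = 0)
    (x : ℕ → Fin d → ℝ) (hx0 : x 0 = x 1)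
    (hx : ∀ t, 1 ≤ t → t ≤ T → ∀ a, x t a =
      Real.exp (η * ((∑ k ∈ Finset.range t, u k a) + u (t - 1) a)) /
        ∑ b, Real.exp (η * ((∑ k ∈ Finset.range t, u k b) + u (t - 1) b))) :
    (⨆ y : stdSimplex ℝ (Fin d),
        ∑ t ∈ Finset.Icc 1 T, ∑ a, u t a * ((y : Fin d → ℝ) a - x t a)) ≤
      Real.log d / η
        + η * ∑ t ∈ Finset.Icc 1 T, ‖u t - u (t - 1)‖ ^ 2
        - (1 / (4 * η)) * ∑ t ∈ Finset.Icc 1 T, (∑ a, |x t a - x (t - 1) a|) ^ 2 := by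
  have : Nonempty (Fin d) := ⟨⟨0, hd⟩⟩
  have hpot := logSumExp_potential_le hη hx0 (fun t h1 h2 => funext fun a => hx t h1 h2 a) hT le_rfl
  have hlog : logSumExp (fun a => η * ∑ k ∈ Finset.range 1, u k a) = Real.log d := by
    simp [logSumExp, hu0]
  rw [hlog] at hpot
  refine ciSup_le fun y => ?_
  have hy1 : ∑ a, (y : Fin d → ℝ) a = 1 := y.2.2
  have hy : η * ∑ t ∈ Finset.Icc 1 T, ∑ a, u t a * (y : Fin d → ℝ) a ≤
      logSumExp (fun a => η * ∑ k ∈ Finset.range (T + 1), u k a) := by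
    have hrange : ∀ a, ∑ k ∈ Finset.range (T + 1), u k a = ∑ t ∈ Finset.Icc 1 T, u t a := by
      intro a
      rw [Finset.range_eq_Ico, Finset.sum_eq_sum_Ico_succ_bot (Nat.succ_pos T), hu0]
      simp [Finset.Ico_add_one_right_eq_Icc]
    calc η * ∑ t ∈ Finset.Icc 1 T, ∑ a, u t a * (y : Fin d → ℝ) a
        = ∑ a, (y : Fin d → ℝ) a * (η * ∑ k ∈ Finset.range (T + 1), u k a) := by
          rw [Finset.sum_comm, Finset.mul_sum]
          refine Finset.sum_congr rfl fun a _ => ?_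
          rw [hrange, ← Finset.sum_mul]
          ring
      _ ≤ ∑ a, (y : Fin d → ℝ) a *
            logSumExp (fun a => η * ∑ k ∈ Finset.range (T + 1), u k a) :=
          Finset.sum_le_sum fun a _ => mul_le_mul_of_nonneg_left
            (le_logSumExp (fun a => η * ∑ k ∈ Finset.range (T + 1), u k a) a) (y.2.1 a)
      _ = _ := by rw [← Finset.sum_mul, hy1, one_mul]
  have hlast := sq_nonneg
    (∑ a, |softmax (fun a => η * ∑ k ∈ Finset.range (T + 1), u k a) a - x T a|)
  simp only [mul_sub, Finset.sum_sub_distrib]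
  refine le_of_mul_le_mul_left ?_ hη
  have hrhs : ∀ A B D : ℝ, η * (A / η + η * B - 1 / (4 * η) * D) = A + η ^ 2 * B - D / 4 := by
    intro A B D
    field_simp
  rw [hrhs, mul_sub]
  linarith
end

section
/- In the estimation-error setup, for any points x^0, x^1,…,x^T ∈ Δ^d, any x ∈ Δ^d, and any η > 0, Σ_{t=1}^T ⟨δ^t, x^t − x⟩ − (1/(8η))·Σ_{t=1}^T ‖x^t − x^{t−1}‖_1² ≤ 2T‖Δ^T‖_∞ + 2η·Σ_{t=1}^{T−1} t²‖Δ^t‖_∞² + 4·Σ_{t=1}^T ε_t. -/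
open Finset

theorem sum_mul_le_norm_mul_sum_abs {ι : Type*} [Fintype ι] (f g : ι → ℝ) :
    ∑ a, f a * g a ≤ ‖f‖ * ∑ a, |g a| := by
  rw [Finset.mul_sum]
  refine Finset.sum_le_sum fun a _ => ?_
  calc f a * g a ≤ |f a * g a| := le_abs_self _
    _ = ‖f a‖ * |g a| := by rw [abs_mul, Real.norm_eq_abs]
    _ ≤ ‖f‖ * |g a| := by gcongr; exact norm_le_pi_norm f a

theorem sum_abs_sub_le_two_of_mem_stdSimplex {ι : Type*} [Fintype ι] {p q : ι → ℝ}
    (hp : p ∈ stdSimplex ℝ ι) (hq : q ∈ stdSimplex ℝ ι) : ∑ a, |p a - q a| ≤ 2 := by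
  calc ∑ a, |p a - q a| ≤ ∑ a, (p a + q a) := by
        refine Finset.sum_le_sum fun a _ => abs_le.2 ⟨?_, ?_⟩ <;> linarith [hp.1 a, hq.1 a]
    _ = 2 := by rw [Finset.sum_add_distrib, hp.2, hq.2]; norm_num

/-- Adding one point of `[0, 1]` to `n` such points moves their mean by at most `1 / (n + 1)`. -/
theorem abs_mean_sub_mean_succ_le {n : ℕ} (hn : 1 ≤ n) {s v : ℝ} (hs0 : 0 ≤ s) (hs : s ≤ n)
    (hv : v ∈ Set.Icc (0 : ℝ) 1) :
    |s / n - (s + v) / (n + 1)| ≤ 1 / ((n : ℝ) + 1) := by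
  have hn' : (0 : ℝ) < n := by exact_mod_cast hn
  have h0 : 0 ≤ s / n := by positivity
  have h1 : s / n ≤ 1 := (div_le_one hn').2 hs
  have key : s / n - (s + v) / (n + 1) = (s / n - v) / (n + 1) := by field_simp; ring
  rw [key, abs_div, abs_of_pos (by positivity : (0 : ℝ) < n + 1)]
  gcongr
  exact abs_le.2 ⟨by linarith [hv.2], by linarith [hv.1]⟩

/-- the error-term bound in the estimation-error setup.  For any points
`x^0,…,x^T ∈ Δ^d`, any `y ∈ Δ^d` and any `η > 0`,
`∑_t ⟨δ^t, x^t − y⟩ − (1/(8η))∑_t ‖x^t − x^{t−1}‖_1² ≤ 2T‖Δ^T‖_∞ + 2η∑_{t<T} t²‖Δ^t‖_∞² + 4∑_t ε_t`. -/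
theorem stmt10 (d T : ℕ) (hd : 1 ≤ d) (hT : 1 ≤ T)
    (η : ℝ) (hη : 0 < η)
    (u : ℕ → Fin d → ℝ) (hu0 : u 0 = 0)
    (hu : ∀ t ∈ Finset.Icc 1 T, ∀ a, u t a ∈ Set.Icc (0 : ℝ) 1)
    (w : Fin d → ℝ) (hw : ∀ a, w a ∈ Set.Icc (0 : ℝ) 1)
    (Uhat : ℕ → Fin d → ℝ) (hUhat0 : Uhat 0 = 0)
    (Δ : ℕ → Fin d → ℝ) (hΔ0 : Δ 0 = 0)
    (hΔ : ∀ t ∈ Finset.Icc 1 T, ∀ a, Δ t a =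
      Uhat t a - ((1 - 1 / (t : ℝ)) * ((1 / (t : ℝ)) * ∑ k ∈ Finset.Icc 1 t, u k a)
        + (1 / (t : ℝ)) * w a))
    (uhat δ' : ℕ → Fin d → ℝ)
    (huhat : ∀ t a, uhat t a = (t : ℝ) * Uhat t a - ((t - 1 : ℕ) : ℝ) * Uhat (t - 1) a)
    (hδ' : ∀ t a, δ' t a = uhat t a - u t a)
    (x : ℕ → Fin d → ℝ) (hx : ∀ t ≤ T, x t ∈ stdSimplex ℝ (Fin d))
    (y : Fin d → ℝ) (hy : y ∈ stdSimplex ℝ (Fin d)) :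
    (∑ t ∈ Finset.Icc 1 T, ∑ a, δ' t a * (x t a - y a))
        - (1 / (8 * η)) * ∑ t ∈ Finset.Icc 1 T, (∑ a, |x t a - x (t - 1) a|) ^ 2 ≤
      2 * (T : ℝ) * ‖Δ T‖
        + 2 * η * ∑ t ∈ Finset.Icc 1 (T - 1), (t : ℝ) ^ 2 * ‖Δ t‖ ^ 2
        + 4 * ∑ t ∈ Finset.Icc 1 T, (1 / (t : ℝ)) := by
  have hb : ∀ n, n + 1 ≤ T → ∀ a,
      |δ' (n + 1) a - (((n : ℝ) + 1) * Δ (n + 1) a - n * Δ n a)| ≤ 1 / ((n : ℝ) + 1) := by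
    intro n hn a
    have hun := hu (n + 1) (by simp; omega) a
    have hΔn := hΔ (n + 1) (by simp; omega) a
    rw [hδ', huhat, hΔn, Finset.sum_Icc_succ_top (by omega), Nat.add_sub_cancel]
    push_cast
    rcases Nat.eq_zero_or_pos n with rfl | hpos
    · have hwa := hw a
      simp only [CharP.cast_eq_zero, zero_add, zero_mul, sub_zero] at hun ⊢
      norm_num
      exact abs_le.2 ⟨by linarith [hun.2, hwa.1], by linarith [hun.1, hwa.2]⟩
    · rw [hΔ n (by simp; omega) a]
      have hmem : ∀ k ∈ Finset.Icc 1 n, u k a ∈ Set.Icc (0 : ℝ) 1 := fun k hk =>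
        hu k (by simp at hk ⊢; omega) a
      have hs0 : 0 ≤ ∑ k ∈ Finset.Icc 1 n, u k a :=
        Finset.sum_nonneg fun k hk => (hmem k hk).1
      have hs : ∑ k ∈ Finset.Icc 1 n, u k a ≤ n := by
        calc ∑ k ∈ Finset.Icc 1 n, u k a ≤ ∑ k ∈ Finset.Icc 1 n, (1 : ℝ) :=
              Finset.sum_le_sum fun k hk => (hmem k hk).2
          _ = n := by simp
      have hn' : (0 : ℝ) < n := by exact_mod_cast hpos
      convert abs_mean_sub_mean_succ_le hpos hs0 hs hun using 2
      field_simp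
      ring
  have main : ∀ n ≤ T, (∑ t ∈ Finset.Icc 1 n, ∑ a, δ' t a * (x t a - y a))
        - (1 / (8 * η)) * ∑ t ∈ Finset.Icc 1 n, (∑ a, |x t a - x (t - 1) a|) ^ 2 ≤
      (n : ℝ) * ∑ a, Δ n a * (x n a - y a)
        + 2 * η * ∑ t ∈ Finset.range n, (t : ℝ) ^ 2 * ‖Δ t‖ ^ 2
        + 4 * ∑ t ∈ Finset.Icc 1 n, (1 / (t : ℝ)) := by
    intro n
    induction n with
    | zero => simp
    | succ n ih =>
      intro hn
      have ih := ih (by omega)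
      rw [Finset.sum_Icc_succ_top (by omega), Finset.sum_Icc_succ_top (by omega),
        Finset.sum_Icc_succ_top (by omega), Finset.sum_range_succ, Nat.add_sub_cancel]
      push_cast
      set b : Fin d → ℝ := fun a =>
        δ' (n + 1) a - (((n : ℝ) + 1) * Δ (n + 1) a - n * Δ n a) with hbdef
      have hpos : (0 : ℝ) < (n : ℝ) + 1 := by positivity
      have hbn : ‖b‖ ≤ 1 / ((n : ℝ) + 1) := (pi_norm_le_iff_of_nonneg (by positivity)).2 (hb n hn)
      have hbias : ∑ a, b a * (x (n + 1) a - y a) ≤ 4 * (1 / ((n : ℝ) + 1)) := by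
        have h1 := sum_mul_le_norm_mul_sum_abs b fun a => x (n + 1) a - y a
        have h2 : ‖b‖ * ∑ a, |x (n + 1) a - y a| ≤ 1 / ((n : ℝ) + 1) * 2 := by
          gcongr
          exact sum_abs_sub_le_two_of_mem_stdSimplex (hx _ hn) hy
        have h3 : 0 < 1 / ((n : ℝ) + 1) := by positivity
        linarith
      have hsplit : ∑ a, δ' (n + 1) a * (x (n + 1) a - y a)
          = ((n : ℝ) + 1) * ∑ a, Δ (n + 1) a * (x (n + 1) a - y a)
            - n * ∑ a, Δ n a * (x n a - y a)
            + n * ∑ a, -Δ n a * (x (n + 1) a - x n a)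
            + ∑ a, b a * (x (n + 1) a - y a) := by
        simp only [Finset.mul_sum, ← Finset.sum_add_distrib, ← Finset.sum_sub_distrib]
        refine Finset.sum_congr rfl fun a _ => ?_
        simp only [hbdef]
        ring
      have hdrift := sum_mul_le_norm_mul_sum_abs (-Δ n) fun a => x (n + 1) a - x n a
      rw [norm_neg] at hdrift
      simp only [Pi.neg_apply] at hdrift
      have hdrift' := mul_le_mul_of_nonneg_left hdrift (Nat.cast_nonneg (α := ℝ) n)
      set N := ∑ a, |x (n + 1) a - x n a|
      have hamgm : (n : ℝ) * (‖Δ n‖ * N)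
          ≤ 2 * η * ((n : ℝ) ^ 2 * ‖Δ n‖ ^ 2) + 1 / (8 * η) * N ^ 2 := by
        have : 2 * η * ((n : ℝ) ^ 2 * ‖Δ n‖ ^ 2) + 1 / (8 * η) * N ^ 2 - n * (‖Δ n‖ * N)
            = 1 / (8 * η) * (4 * η * (n * ‖Δ n‖) - N) ^ 2 := by
          field_simp
          ring
        have : 0 ≤ 1 / (8 * η) * (4 * η * (n * ‖Δ n‖) - N) ^ 2 := by positivity
        linarith
      linarith
  have hlast : (T : ℝ) * ∑ a, Δ T a * (x T a - y a) ≤ 2 * T * ‖Δ T‖ := by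
    have h1 := sum_mul_le_norm_mul_sum_abs (Δ T) fun a => x T a - y a
    have h2 := mul_le_mul_of_nonneg_left
      (sum_abs_sub_le_two_of_mem_stdSimplex (hx T le_rfl) hy) (norm_nonneg (Δ T))
    have h3 := mul_le_mul_of_nonneg_left (h1.trans h2) (Nat.cast_nonneg (α := ℝ) T)
    linarith
  have hrange : ∑ t ∈ Finset.range T, (t : ℝ) ^ 2 * ‖Δ t‖ ^ 2
      = ∑ t ∈ Finset.Icc 1 (T - 1), (t : ℝ) ^ 2 * ‖Δ t‖ ^ 2 := by
    symm
    refine Finset.sum_subset (fun t ht => by simp at ht ⊢; omega) fun t ht ht' => ?_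
    have : t = 0 := by simp at ht ht'; omega
    simp [this]
  have hT' := main T le_rfl
  rw [hrange] at hT'
  linarith
end

section
/- In the setting of the previous sampling model: with probability at least 1 − d·δ/t² − d·exp(−B·ε²/(2d²)), every action a ∈ {1,…,m} satisfies |Û[a] − ū[a]| ≤ 2√(d·log(B·t²/δ)/(B·ε)). -/
open Finset

/-- Empirical estimator of the utility vector: `Û[a]` is the average reward over the rounds in
which action `a` was sampled (and `0` if `a` was never sampled). -/
noncomputable def empEst {m B : ℕ} {S : Type*} [Fintype S] [DecidableEq S]
    (f : Fin m → S → ℝ) (ω : Fin B → Fin m × S) (a : Fin m) : ℝ :=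
  if (Finset.univ.filter fun k => (ω k).1 = a).card = 0 then 0
  else (∑ k ∈ Finset.univ.filter fun k => (ω k).1 = a, f (ω k).1 (ω k).2) /
    ((Finset.univ.filter fun k => (ω k).1 = a).card : ℝ)

/-- Hoeffding's lemma for a finitely supported distribution with weights `w`. -/
theorem sum_mul_exp_le_of_mem_Icc {X : Type*} [Fintype X] (w : X → ℝ) (hw0 : ∀ x, 0 ≤ w x)
    (hw1 : ∑ x, w x = 1) (g : X → ℝ) (hg : ∀ x, g x ∈ Set.Icc (0 : ℝ) 1) (c : ℝ) :
    ∑ x, w x * Real.exp (c * (g x - ∑ y, w y * g y)) ≤ Real.exp (c ^ 2 / 8) := by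
  let _ : MeasurableSpace X := ⊤
  let μ : MeasureTheory.Measure X :=
    ∑ x, ENNReal.ofReal (w x) • MeasureTheory.Measure.dirac x
  have hμ : MeasureTheory.IsProbabilityMeasure μ := by
    constructor
    simp only [μ, MeasureTheory.Measure.finsetSum_apply, MeasureTheory.Measure.smul_apply,
      MeasureTheory.measure_univ, smul_eq_mul, mul_one]
    rw [← ENNReal.ofReal_sum_of_nonneg fun x _ => hw0 x, hw1, ENNReal.ofReal_one]
  have hint (h : X → ℝ) : ∫ x, h x ∂μ = ∑ x, w x * h x := by
    have hfin (x : X) : MeasureTheory.IsFiniteMeasure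
        (ENNReal.ofReal (w x) • MeasureTheory.Measure.dirac x) :=
      MeasureTheory.Measure.smul_finite _ ENNReal.ofReal_ne_top
    rw [MeasureTheory.integral_finsetSum_measure fun x _ => .of_finite]
    simp [MeasureTheory.integral_smul_measure, MeasureTheory.integral_dirac,
      ENNReal.toReal_ofReal (hw0 _)]
  have h := (ProbabilityTheory.hasSubgaussianMGF_of_mem_Icc (μ := μ) (X := g) (a := 0) (b := 1)
    (measurable_of_finite g).aemeasurable (.of_forall hg)).mgf_le c
  rw [ProbabilityTheory.mgf, hint, hint] at h
  refine h.trans_eq ?_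
  congr 1
  simp
  ring

/-- Chernoff's bound for the product of `B` copies of a finite distribution with weights `w`. -/
theorem sum_indicator_prod_le {X : Type*} [Fintype X] {B : ℕ} (w g : X → ℝ)
    (hw : ∀ x, 0 ≤ w x) (hg : ∀ x, 0 ≤ g x) {M C : ℝ} (hM : ∑ x, w x * g x ≤ M) (hC : 0 < C)
    (E : Set (Fin B → X)) (hE : ∀ ω ∈ E, C ≤ ∏ k, g (ω k)) :
    ∑ ω, E.indicator (fun ω => ∏ k, w (ω k)) ω ≤ M ^ B / C := by
  classical
  rw [le_div_iff₀ hC, sum_mul]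
  calc ∑ ω, E.indicator (fun ω => ∏ k, w (ω k)) ω * C
      ≤ ∑ ω : Fin B → X, ∏ k, w (ω k) * g (ω k) := by
        refine sum_le_sum fun ω _ => ?_
        rw [prod_mul_distrib]
        by_cases h : ω ∈ E
        · rw [Set.indicator_of_mem h]
          exact mul_le_mul_of_nonneg_left (hE ω h) (prod_nonneg fun k _ => hw _)
        · rw [Set.indicator_of_notMem h, zero_mul]
          exact mul_nonneg (prod_nonneg fun k _ => hw _) (prod_nonneg fun k _ => hg _)
    _ = (∑ x, w x * g x) ^ B := (Fintype.sum_pow (fun x => w x * g x) B).symm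
    _ ≤ M ^ B := pow_le_pow_left₀ (sum_nonneg fun x _ => mul_nonneg (hw x) (hg x)) hM B

theorem sum_indicator_count_lt_le {m B : ℕ} {S : Type*} [Fintype S]
    (p : Fin m → ℝ) (hp0 : ∀ a, 0 ≤ p a) (hp1 : ∑ a, p a = 1)
    (q : S → ℝ) (hq0 : ∀ s, 0 ≤ q s) (hq1 : ∑ s, q s = 1) (a : Fin m) :
    ∑ ω : Fin B → Fin m × S, Set.indicator
        {ω | ((univ.filter fun k => (ω k).1 = a).card : ℝ) < B * p a / 2}
        (fun ω => ∏ k, p (ω k).1 * q (ω k).2) ω ≤ Real.exp (-(B * p a ^ 2 / 2)) := by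
  have hmgf := sum_mul_exp_le_of_mem_Icc p hp0 hp1 (fun b => if b = a then 1 else 0)
    (fun b => by split_ifs <;> simp) (-(2 * p a))
  simp only [mul_ite, mul_one, mul_zero, sum_ite_eq', mem_univ, if_true] at hmgf
  have key := sum_indicator_prod_le (B := B) (fun x : Fin m × S => p x.1 * q x.2)
    (fun x => Real.exp (-(2 * p a) * ((if x.1 = a then 1 else 0) - p a)))
    (fun x => mul_nonneg (hp0 _) (hq0 _)) (fun x => (Real.exp_pos _).le)
    (M := Real.exp ((-(2 * p a)) ^ 2 / 8)) (by
      rw [Fintype.sum_prod_type]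
      refine le_trans (le_of_eq ?_) hmgf
      refine sum_congr rfl fun b _ => ?_
      rw [← mul_one (p b * Real.exp _), ← hq1, mul_sum]
      refine sum_congr rfl fun s _ => ?_
      ring)
    (Real.exp_pos (B * p a ^ 2))
    {ω | ((univ.filter fun k => (ω k).1 = a).card : ℝ) < B * p a / 2} (by
      intro ω hω
      rw [Set.mem_ofPred_eq, ← sum_boole] at hω
      rw [← Real.exp_sum, Real.exp_le_exp, ← mul_sum, sum_sub_distrib]
      simp only [sum_const, card_univ, Fintype.card_fin, nsmul_eq_mul]
      nlinarith [hp0 a])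
  refine key.trans_eq ?_
  rw [← Real.exp_nat_mul, ← Real.exp_sub]
  congr 1
  ring

theorem sum_indicator_deviation_le {m B : ℕ} {S : Type*} [Fintype S]
    (p : Fin m → ℝ) (hp0 : ∀ a, 0 ≤ p a) (hp1 : ∑ a, p a = 1)
    (q : S → ℝ) (hq0 : ∀ s, 0 ≤ q s) (hq1 : ∑ s, q s = 1)
    (f : Fin m → S → ℝ) (hf : ∀ a s, f a s ∈ Set.Icc (0 : ℝ) 1) (a : Fin m)
    (σ r n : ℝ) (hσ : σ ^ 2 = 1) (hr : 0 ≤ r) :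
    ∑ ω : Fin B → Fin m × S, Set.indicator
        {ω | n ≤ ((univ.filter fun k => (ω k).1 = a).card : ℝ) ∧
          r * ((univ.filter fun k => (ω k).1 = a).card : ℝ) ≤
            σ * ∑ k ∈ univ.filter fun k => (ω k).1 = a,
              (f (ω k).1 (ω k).2 - ∑ s, q s * f a s)}
        (fun ω => ∏ k, p (ω k).1 * q (ω k).2) ω ≤ Real.exp (-(2 * r ^ 2 * n)) := by
  have hmgf := sum_mul_exp_le_of_mem_Icc q hq0 hq1 (f a) (hf a) (4 * r * σ)
  have hsq : (4 * r * σ) ^ 2 / 8 = 2 * r ^ 2 := by rw [mul_pow, hσ]; ring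
  rw [hsq] at hmgf
  have key := sum_indicator_prod_le (B := B) (fun x : Fin m × S => p x.1 * q x.2)
    (fun x => Real.exp (if x.1 = a then
      4 * r * σ * (f x.1 x.2 - ∑ s, q s * f a s) - 2 * r ^ 2 else 0))
    (fun x => mul_nonneg (hp0 _) (hq0 _)) (fun x => (Real.exp_pos _).le) (M := 1) (by
      rw [Fintype.sum_prod_type, ← hp1]
      refine sum_le_sum fun b _ => ?_
      simp only [mul_assoc, ← mul_sum]
      refine mul_le_of_le_one_right (hp0 b) ?_
      by_cases hb : b = a
      · subst hb
        simp only [if_true, Real.exp_sub, ← mul_div_assoc]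
        rw [← sum_div, div_le_one (Real.exp_pos _)]
        simpa only [mul_assoc] using hmgf
      · simp [hb, hq1])
    (Real.exp_pos (2 * r ^ 2 * n))
    {ω | n ≤ ((univ.filter fun k => (ω k).1 = a).card : ℝ) ∧
      r * ((univ.filter fun k => (ω k).1 = a).card : ℝ) ≤
        σ * ∑ k ∈ univ.filter fun k => (ω k).1 = a,
          (f (ω k).1 (ω k).2 - ∑ s, q s * f a s)} (by
      rintro ω ⟨h1, h2⟩
      rw [← Real.exp_sum, Real.exp_le_exp, ← sum_filter, sum_sub_distrib, ← mul_sum]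
      simp only [sum_const, nsmul_eq_mul]
      nlinarith [mul_le_mul_of_nonneg_left h2 hr, mul_le_mul_of_nonneg_left h1 (sq_nonneg r)])
  refine key.trans_eq ?_
  rw [one_pow, one_div, Real.exp_neg]

/-- in the sampling model for utility estimation (B i.i.d. pairs `(a^k, b^k)` with
`a^k ∼ p`, `p[a] ≥ ε/d`, and `b^k ∼ q` independent, rewards `f(a^k,b^k) ∈ [0,1]`), with
probability at least `1 − dδ/t² − d·exp(−Bε²/(2d²))` every action `a` satisfies
`|Û[a] − ū[a]| ≤ 2√(d·log(Bt²/δ)/(Bε))`, where `ū[a] = E_{b∼q} f(a,b)`.  Probabilities over the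
finite sample space `(Fin m × S)^B` are written as explicit weighted sums. -/
theorem stmt13 (m d B t : ℕ) (hm : 1 ≤ m) (hmd : m ≤ d) (hB : 1 ≤ B) (ht : 1 ≤ t)
    (ε δ : ℝ) (hε0 : 0 < ε) (hε1 : ε ≤ 1) (hδ0 : 0 < δ) (hδ1 : δ < 1)
    (S : Type) [Fintype S] [DecidableEq S] [Nonempty S]
    (p : Fin m → ℝ) (hp0 : ∀ a, 0 ≤ p a) (hp1 : ∑ a, p a = 1)
    (hplb : ∀ a, ε / (d : ℝ) ≤ p a)
    (q : S → ℝ) (hq0 : ∀ s, 0 ≤ q s) (hq1 : ∑ s, q s = 1)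
    (f : Fin m → S → ℝ) (hf : ∀ a s, f a s ∈ Set.Icc (0 : ℝ) 1) :
    1 - (d : ℝ) * δ / (t : ℝ) ^ 2 - (d : ℝ) * Real.exp (-(B : ℝ) * ε ^ 2 / (2 * (d : ℝ) ^ 2)) ≤
      ∑ ω : Fin B → Fin m × S,
        Set.indicator
          {ω' : Fin B → Fin m × S | ∀ a, |empEst f ω' a - ∑ s, q s * f a s| ≤
            2 * Real.sqrt ((d : ℝ) * Real.log ((B : ℝ) * (t : ℝ) ^ 2 / δ) / ((B : ℝ) * ε))}
          (fun ω' => ∏ k, p (ω' k).1 * q (ω' k).2) ω := by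
  classical
  have hd : (0 : ℝ) < d := by exact_mod_cast lt_of_lt_of_le hm hmd
  have hd1 : (1 : ℝ) ≤ d := by exact_mod_cast hm.trans hmd
  have hBr : (1 : ℝ) ≤ B := by exact_mod_cast hB
  have htr : (1 : ℝ) ≤ t := by exact_mod_cast ht
  have hB0 : (0 : ℝ) < B := by linarith
  have ht2 : (1 : ℝ) ≤ (t : ℝ) ^ 2 := one_le_pow₀ htr
  have hw0 (ω : Fin B → Fin m × S) : 0 ≤ ∏ k, p (ω k).1 * q (ω k).2 :=
    prod_nonneg fun k _ => mul_nonneg (hp0 _) (hq0 _)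
  have hBt : 1 ≤ (B : ℝ) * (t : ℝ) ^ 2 := one_le_mul_of_one_le_of_one_le hBr ht2
  set x : ℝ := δ / (B * (t : ℝ) ^ 2) with hx
  have hx0 : 0 < x := by positivity
  have hxδ : x ≤ δ / (t : ℝ) ^ 2 := by
    rw [hx]
    gcongr
    exact le_mul_of_one_le_left (by positivity) hBr
  rcases lt_or_ge (1 / 2) x with hlarge | hsmall
  · refine le_trans ?_ (sum_nonneg fun ω _ => Set.indicator_nonneg (fun ω _ => hw0 ω) ω)
    have hlt : (B : ℝ) * (t : ℝ) ^ 2 < 2 := by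
      rw [hx, lt_div_iff₀ (by positivity)] at hlarge
      linarith
    have hB2 : B = 1 := by
      have : (B : ℝ) < 2 := lt_of_le_of_lt (le_mul_of_one_le_right hB0.le ht2) hlt
      have : B < 2 := by exact_mod_cast this
      omega
    have hexp : 1 / 2 ≤ Real.exp (-(B : ℝ) * ε ^ 2 / (2 * (d : ℝ) ^ 2)) := by
      have h1 : ε ^ 2 / (2 * (d : ℝ) ^ 2) ≤ 1 / 2 := by
        rw [div_le_div_iff₀ (by positivity) (by norm_num)]
        nlinarith
      have h2 := Real.add_one_le_exp (-(B : ℝ) * ε ^ 2 / (2 * (d : ℝ) ^ 2))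
      have h3 : -(B : ℝ) * ε ^ 2 / (2 * (d : ℝ) ^ 2) = -(ε ^ 2 / (2 * (d : ℝ) ^ 2)) := by
        rw [hB2]; push_cast; ring
      rw [h3] at h2 ⊢
      linarith
    rw [mul_div_assoc]
    nlinarith
  set L : ℝ := Real.log ((B : ℝ) * (t : ℝ) ^ 2 / δ) with hL
  have hL0 : 0 ≤ L := Real.log_nonneg (by rw [le_div_iff₀ hδ0]; linarith)
  have hexpL : Real.exp (-(4 * L)) = x ^ 4 := by
    have h1 : Real.exp (-L) = x := by
      rw [Real.exp_neg, hL, Real.exp_log (by positivity), inv_div]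
    rw [← h1, ← Real.exp_nat_mul]
    congr 1
    push_cast
    ring
  set r : ℝ := 2 * Real.sqrt ((d : ℝ) * L / ((B : ℝ) * ε)) with hr
  have hr0 : 0 ≤ r := by positivity
  set n : ℝ := B * ε / (2 * d) with hn
  have hrn : 2 * r ^ 2 * n = 4 * L := by
    rw [hr, mul_pow, Real.sq_sqrt (by positivity), hn]
    field_simp
    ring
  let N (ω : Fin B → Fin m × S) (a : Fin m) : ℝ := ((univ.filter fun k => (ω k).1 = a).card : ℝ)
  let D (ω : Fin B → Fin m × S) (a : Fin m) : ℝ :=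
    ∑ k ∈ univ.filter fun k => (ω k).1 = a, (f (ω k).1 (ω k).2 - ∑ s, q s * f a s)
  let W (ω : Fin B → Fin m × S) : ℝ := ∏ k, p (ω k).1 * q (ω k).2
  let few (a : Fin m) : Set (Fin B → Fin m × S) := {ω | N ω a < B * p a / 2}
  let dev (σ : ℝ) (a : Fin m) : Set (Fin B → Fin m × S) :=
    {ω | n ≤ N ω a ∧ r * N ω a ≤ σ * D ω a}
  let good : Set (Fin B → Fin m × S) := {ω | ∀ a, |empEst f ω a - ∑ s, q s * f a s| ≤ r}
  have hcover (ω) : W ω ≤ good.indicator W ω +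
      ∑ a, ((few a).indicator W ω + (dev 1 a).indicator W ω + (dev (-1) a).indicator W ω) := by
    have hnn (E : Set (Fin B → Fin m × S)) : 0 ≤ E.indicator W ω :=
      Set.indicator_nonneg (fun ω _ => hw0 ω) ω
    have hterm (a) : 0 ≤ (few a).indicator W ω + (dev 1 a).indicator W ω +
        (dev (-1) a).indicator W ω := add_nonneg (add_nonneg (hnn _) (hnn _)) (hnn _)
    by_cases hg : ω ∈ good
    · rw [Set.indicator_of_mem hg]
      linarith [sum_nonneg fun a (_ : a ∈ univ) => hterm a]
    · obtain ⟨a, ha⟩ : ∃ a, r < |empEst f ω a - ∑ s, q s * f a s| := by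
        simpa [good] using hg
      have hsum := single_le_sum (fun a _ => hterm a) (mem_univ a)
      refine le_trans ?_ (hsum.trans (le_add_of_nonneg_left (hnn _)))
      by_cases hfew : ω ∈ few a
      · rw [Set.indicator_of_mem hfew]
        linarith [hnn (dev 1 a), hnn (dev (-1) a)]
      · have hnp : n ≤ B * p a / 2 := by
          calc n = B * (ε / d) / 2 := by rw [hn]; field_simp
            _ ≤ _ := by gcongr; exact hplb a
        have hnN : n ≤ N ω a := hnp.trans (not_lt.mp hfew)
        have hN0 : 0 < N ω a := lt_of_lt_of_le (by positivity) hnN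
        have hest : empEst f ω a - ∑ s, q s * f a s = D ω a / N ω a := by
          have hc : (univ.filter fun k => (ω k).1 = a).card ≠ 0 :=
            Nat.cast_ne_zero.mp hN0.ne'
          rw [empEst, if_neg hc, eq_div_iff hN0.ne', sub_mul]
          simp only [D, sum_sub_distrib, sum_const, nsmul_eq_mul]
          rw [div_mul_cancel₀ _ hN0.ne']
          ring
        rw [hest, abs_div, abs_of_pos hN0, lt_div_iff₀ hN0, lt_abs] at ha
        rcases ha with h | h
        · have : ω ∈ dev 1 a := ⟨hnN, by linarith⟩
          rw [Set.indicator_of_mem this]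
          linarith [hnn (few a), hnn (dev (-1) a)]
        · have : ω ∈ dev (-1) a := ⟨hnN, by linarith⟩
          rw [Set.indicator_of_mem this]
          linarith [hnn (few a), hnn (dev 1 a)]
  have htotal : ∑ ω, W ω = 1 := by
    have : ∑ y : Fin m × S, p y.1 * q y.2 = 1 := by
      simp [Fintype.sum_prod_type, ← mul_sum, hq1, hp1]
    rw [← one_pow B, ← this, Fintype.sum_pow]
  have hact (a) : ∑ ω, ((few a).indicator W ω + (dev 1 a).indicator W ω +
      (dev (-1) a).indicator W ω) ≤
      δ / (t : ℝ) ^ 2 + Real.exp (-(B : ℝ) * ε ^ 2 / (2 * (d : ℝ) ^ 2)) := by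
    have h1 : ∑ ω, (few a).indicator W ω ≤ _ :=
      sum_indicator_count_lt_le p hp0 hp1 q hq0 hq1 a
    have h2 : ∑ ω, (dev 1 a).indicator W ω ≤ _ :=
      sum_indicator_deviation_le p hp0 hp1 q hq0 hq1 f hf a 1 r n (by norm_num) hr0
    have h3 : ∑ ω, (dev (-1) a).indicator W ω ≤ _ :=
      sum_indicator_deviation_le p hp0 hp1 q hq0 hq1 f hf a (-1) r n (by norm_num) hr0
    rw [hrn, hexpL] at h2 h3
    have h4 : 2 * x ^ 4 ≤ x := by
      have : x ^ 3 ≤ (1 / 2) ^ 3 := pow_le_pow_left₀ hx0.le hsmall 3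
      nlinarith
    have h5 : Real.exp (-(B * p a ^ 2 / 2)) ≤
        Real.exp (-(B : ℝ) * ε ^ 2 / (2 * (d : ℝ) ^ 2)) := by
      rw [Real.exp_le_exp]
      calc -(B * p a ^ 2 / 2) ≤ -(B * (ε / d) ^ 2 / 2) := by
            gcongr
            exact hplb a
        _ = _ := by field_simp
    rw [sum_add_distrib, sum_add_distrib]
    linarith
  have hfinal := sum_le_sum fun ω (_ : ω ∈ univ) => hcover ω
  rw [htotal, sum_add_distrib, sum_comm] at hfinal
  have hbad := sum_le_sum fun a (_ : a ∈ (univ : Finset (Fin m))) => hact a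
  rw [sum_const, card_univ, Fintype.card_fin, nsmul_eq_mul] at hbad
  have hmd' : (m : ℝ) * (δ / (t : ℝ) ^ 2 + Real.exp (-(B : ℝ) * ε ^ 2 / (2 * (d : ℝ) ^ 2))) ≤
      d * (δ / (t : ℝ) ^ 2 + Real.exp (-(B : ℝ) * ε ^ 2 / (2 * (d : ℝ) ^ 2))) := by
    gcongr
  change _ ≤ ∑ ω, good.indicator W ω
  rw [mul_div_assoc]
  linarith
end

section
/- In the importance-weighted regret-estimation model: fix δ ∈ (0,1). With probability at least 1 − δ, simultaneously for every epoch index t ≥ 1 the true and estimated cumulative regrets satisfy |Reg^{T_t} − R̃eg^{T_t}| ≤ 4·m·√(Σ_{k=1}^t k²·B_k) · log(π²·m·t²/(3δ)), where T_t := Σ_{k=1}^t B_k. -/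
open Finset MeasureTheory ProbabilityTheory

/-- The chord of `exp` over `[-c * l, c * l]` lies above it. -/
lemma exp_mul_le_cosh_add_sinh {x c : ℝ} (hc : 0 < c) (hx : |x| ≤ c) (l : ℝ) :
    Real.exp (l * x) ≤ Real.cosh (l * c) + Real.sinh (l * c) / c * x := by
  obtain ⟨h1, h2⟩ := abs_le.1 hx
  have h3 : 0 ≤ (c + x) / (2 * c) := div_nonneg (by linarith) (by linarith)
  have h4 : 0 ≤ (c - x) / (2 * c) := div_nonneg (by linarith) (by linarith)
  have key := convexOn_exp.2 (Set.mem_univ (l * c)) (Set.mem_univ (-(l * c))) h3 h4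
    (by field_simp; ring)
  simp only [smul_eq_mul] at key
  have e : (c + x) / (2 * c) * (l * c) + (c - x) / (2 * c) * -(l * c) = l * x := by
    field_simp; ring
  rw [e] at key
  refine key.trans_eq ?_
  rw [Real.cosh_eq, Real.sinh_eq]
  field_simp
  ring

/-- Two indexed families that are uniformly `ε`-close have `ε`-close suprema. -/
lemma abs_iSup_sub_iSup_le {ι : Type*} [Nonempty ι] {f g : ι → ℝ} {ε : ℝ}
    (hf : BddAbove (Set.range f)) (hg : BddAbove (Set.range g)) (h : ∀ i, |f i - g i| ≤ ε) :
    |(⨆ i, f i) - ⨆ i, g i| ≤ ε := by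
  rw [abs_le]
  constructor
  · have : (⨆ i, g i) ≤ (⨆ i, f i) + ε := ciSup_le fun i => by
      linarith [le_ciSup hf i, (abs_le.1 (h i)).1]
    linarith
  · have : (⨆ i, f i) ≤ (⨆ i, g i) + ε := ciSup_le fun i => by
      linarith [le_ciSup hg i, (abs_le.1 (h i)).2]
    linarith

/-- The support functions of the simplex at two vectors that are `ε`-close coordinatewise
are `ε`-close. -/
lemma abs_iSup_stdSimplex_sub_le {m : ℕ} (hm : 1 ≤ m) {v w : Fin m → ℝ} {ε : ℝ}
    (h : ∀ b, |v b - w b| ≤ ε) :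
    |(⨆ y : stdSimplex ℝ (Fin m), ∑ b, v b * (y : Fin m → ℝ) b)
      - ⨆ y : stdSimplex ℝ (Fin m), ∑ b, w b * (y : Fin m → ℝ) b| ≤ ε := by
  have : Nonempty (stdSimplex ℝ (Fin m)) :=
    ⟨⟨_, single_mem_stdSimplex ℝ (⟨0, hm⟩ : Fin m)⟩⟩
  have bdd : ∀ z : Fin m → ℝ, BddAbove (Set.range fun y : stdSimplex ℝ (Fin m) =>
      ∑ b, z b * (y : Fin m → ℝ) b) := by
    intro z
    refine ⟨∑ b, |z b|, ?_⟩
    rintro _ ⟨y, rfl⟩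
    refine Finset.sum_le_sum fun b _ => (le_abs_self _).trans ?_
    have h0 : 0 ≤ (y : Fin m → ℝ) b := y.2.1 b
    have h1 : (y : Fin m → ℝ) b ≤ 1 := (mem_Icc_of_mem_stdSimplex y.2 b).2
    rw [abs_mul, abs_of_nonneg h0]
    exact mul_le_of_le_one_right (abs_nonneg _) h1
  refine abs_iSup_sub_iSup_le (bdd v) (bdd w) fun y => ?_
  rw [← Finset.sum_sub_distrib]
  calc |∑ b, (v b * (y : Fin m → ℝ) b - w b * (y : Fin m → ℝ) b)|
      ≤ ∑ b, |v b * (y : Fin m → ℝ) b - w b * (y : Fin m → ℝ) b| := Finset.abs_sum_le_sum_abs _ _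
    _ ≤ ∑ b, ε * (y : Fin m → ℝ) b := Finset.sum_le_sum fun b _ => by
        have h0 : 0 ≤ (y : Fin m → ℝ) b := y.2.1 b
        rw [← sub_mul, abs_mul, abs_of_nonneg h0]
        exact mul_le_mul_of_nonneg_right (h b) h0
    _ = ε := by
        have h1 : ∑ b, (y : Fin m → ℝ) b = 1 := y.2.2
        rw [← Finset.mul_sum, h1, mul_one]

/-- Summing block by block over consecutive blocks of lengths `B 1, …, B t`. -/
lemma sum_Icc_blocks {B T : ℕ → ℕ} (hT : ∀ t, T t = ∑ k ∈ Finset.Icc 1 t, B k)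
    (f : ℕ → ℝ) (t : ℕ) :
    ∑ k ∈ Finset.Icc 1 t, ∑ r ∈ Finset.Icc (T (k - 1) + 1) (T k), f r
      = ∑ r ∈ Finset.Icc 1 (T t), f r := by
  induction t with
  | zero => simp [hT]
  | succ t ih =>
    rw [Finset.sum_Icc_succ_top (by omega), ih, Nat.add_sub_cancel]
    have hle : T t ≤ T (t + 1) := by
      rw [hT, hT, Finset.sum_Icc_succ_top (by omega)]; omega
    have e : ∀ p q : ℕ, Finset.Icc (p + 1) q = Finset.Ioc p q := fun p q => by
      ext; simp
    rw [e (T t), ← zero_add 1, e 0, e 0]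
    exact Finset.sum_Ioc_consecutive f (Nat.zero_le _) hle

section MartingaleDifferences

variable {Ω : Type*} {mΩ : MeasurableSpace Ω} {P : Measure Ω} [IsProbabilityMeasure P]
  {F : Filtration ℕ mΩ} {d : ℕ → Ω → ℝ} {c : ℕ → ℝ}

lemma stronglyMeasurable_sum_of_adapted
    (hd : ∀ r, 1 ≤ r → StronglyMeasurable[F r] (d r)) (n : ℕ) :
    StronglyMeasurable[F n] fun ω => ∑ r ∈ Finset.Icc 1 n, d r ω :=
  Finset.stronglyMeasurable_fun_sum _ fun r hr =>
    (hd r (Finset.mem_Icc.1 hr).1).mono (F.mono (Finset.mem_Icc.1 hr).2)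

lemma exp_mul_sum_le (hb : ∀ r, 1 ≤ r → ∀ ω, |d r ω| ≤ c r) (l : ℝ) (n : ℕ) (ω : Ω) :
    Real.exp (l * ∑ r ∈ Finset.Icc 1 n, d r ω) ≤ Real.exp (|l| * ∑ r ∈ Finset.Icc 1 n, c r) := by
  refine Real.exp_le_exp.2 ((le_abs_self _).trans ?_)
  rw [abs_mul]
  refine mul_le_mul_of_nonneg_left ((Finset.abs_sum_le_sum_abs _ _).trans ?_) (abs_nonneg _)
  exact Finset.sum_le_sum fun r hr => hb r (Finset.mem_Icc.1 hr).1 ω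

lemma integrable_exp_mul_sum (hd : ∀ r, 1 ≤ r → StronglyMeasurable[F r] (d r))
    (hb : ∀ r, 1 ≤ r → ∀ ω, |d r ω| ≤ c r) (l : ℝ) (n : ℕ) :
    Integrable (fun ω => Real.exp (l * ∑ r ∈ Finset.Icc 1 n, d r ω)) P := by
  refine Integrable.of_bound (C := Real.exp (|l| * ∑ r ∈ Finset.Icc 1 n, c r)) ?_
    (ae_of_all _ fun ω => ?_)
  · exact (Real.continuous_exp.comp_stronglyMeasurable (((stronglyMeasurable_sum_of_adapted hd n).mono
      (F.le n)).const_mul l)).aestronglyMeasurable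
  · rw [Real.norm_eq_abs, Real.abs_exp]
    exact exp_mul_sum_le hb l n ω

/-- A sum of bounded martingale differences has a sub-Gaussian moment generating function. -/
lemma integral_exp_mul_sum_le (hc : ∀ r, 1 ≤ r → 0 < c r)
    (hd : ∀ r, 1 ≤ r → StronglyMeasurable[F r] (d r))
    (hb : ∀ r, 1 ≤ r → ∀ ω, |d r ω| ≤ c r)
    (h0 : ∀ r, 1 ≤ r → P[d r|F (r - 1)] =ᵐ[P] 0) (l : ℝ) (n : ℕ) :
    ∫ ω, Real.exp (l * ∑ r ∈ Finset.Icc 1 n, d r ω) ∂P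
      ≤ Real.exp (l ^ 2 / 2 * ∑ r ∈ Finset.Icc 1 n, c r ^ 2) := by
  induction n with
  | zero => simp
  | succ n ih =>
    have hn : 1 ≤ n + 1 := by omega
    set Z : Ω → ℝ := fun ω => Real.exp (l * ∑ r ∈ Finset.Icc 1 n, d r ω) with hZ
    have hZm : StronglyMeasurable[F n] Z := Real.continuous_exp.comp_stronglyMeasurable
      ((stronglyMeasurable_sum_of_adapted hd n).const_mul l)
    have hZi : Integrable Z P := integrable_exp_mul_sum hd hb l n
    have hdm : AEStronglyMeasurable (d (n + 1)) P :=
      ((hd (n + 1) hn).mono (F.le _)).aestronglyMeasurable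
    have hdi : Integrable (d (n + 1)) P :=
      Integrable.of_bound hdm (c (n + 1)) (ae_of_all _ fun ω => hb _ hn ω)
    have hZd : Integrable (fun ω => Z ω * d (n + 1) ω) P :=
      hZi.mul_bdd hdm (ae_of_all _ fun ω => hb _ hn ω)
    have hzero : ∫ ω, Z ω * d (n + 1) ω ∂P = 0 := by
      have h1 := condExp_mul_of_stronglyMeasurable_left hZm hZd hdi
      have h2 := h0 (n + 1) hn
      rw [Nat.add_sub_cancel] at h2
      have h3 : P[Z * d (n + 1)|F n] =ᵐ[P] 0 := by
        filter_upwards [h1, h2] with ω h1 h2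
        simp [h1, h2]
      have := integral_condExp (μ := P) (f := Z * d (n + 1)) (F.le n)
      rw [integral_congr_ae h3] at this
      simpa using this.symm
    have hcn := hc (n + 1) hn
    calc ∫ ω, Real.exp (l * ∑ r ∈ Finset.Icc 1 (n + 1), d r ω) ∂P
        ≤ ∫ ω, (Real.cosh (l * c (n + 1)) * Z ω
            + Real.sinh (l * c (n + 1)) / c (n + 1) * (Z ω * d (n + 1) ω)) ∂P := by
          refine integral_mono (integrable_exp_mul_sum hd hb l (n + 1))
            ((hZi.const_mul _).add (hZd.const_mul _)) fun ω => ?_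
          simp only [Finset.sum_Icc_succ_top hn, mul_add, Real.exp_add]
          have := mul_le_mul_of_nonneg_left
            (exp_mul_le_cosh_add_sinh hcn (hb _ hn ω) l) (Real.exp_pos
              (l * ∑ r ∈ Finset.Icc 1 n, d r ω)).le
          refine this.trans_eq ?_
          simp only [hZ]
          ring
      _ = Real.cosh (l * c (n + 1)) * ∫ ω, Z ω ∂P := by
          rw [integral_add (hZi.const_mul _) (hZd.const_mul _), integral_const_mul,
            integral_const_mul, hzero, mul_zero, add_zero]
      _ ≤ Real.exp ((l * c (n + 1)) ^ 2 / 2)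
            * Real.exp (l ^ 2 / 2 * ∑ r ∈ Finset.Icc 1 n, c r ^ 2) :=
          mul_le_mul (Real.cosh_le_exp_half_sq _) ih (integral_nonneg fun ω => (Real.exp_pos _).le)
            (Real.exp_pos _).le
      _ = _ := by
          rw [← Real.exp_add, Finset.sum_Icc_succ_top hn]
          congr 1
          ring

/-- One-sided Azuma–Hoeffding inequality. -/
lemma measureReal_sum_ge_le (hc : ∀ r, 1 ≤ r → 0 < c r)
    (hd : ∀ r, 1 ≤ r → StronglyMeasurable[F r] (d r))
    (hb : ∀ r, 1 ≤ r → ∀ ω, |d r ω| ≤ c r)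
    (h0 : ∀ r, 1 ≤ r → P[d r|F (r - 1)] =ᵐ[P] 0) (n : ℕ) {ε : ℝ} (hε : 0 ≤ ε) :
    P.real {ω | ε ≤ ∑ r ∈ Finset.Icc 1 n, d r ω}
      ≤ Real.exp (-ε ^ 2 / (2 * ∑ r ∈ Finset.Icc 1 n, c r ^ 2)) := by
  set C := ∑ r ∈ Finset.Icc 1 n, c r ^ 2 with hC
  have hC0 : 0 ≤ C := Finset.sum_nonneg fun r _ => sq_nonneg _
  have h := measure_ge_le_exp_mul_mgf (μ := P) (X := fun ω => ∑ r ∈ Finset.Icc 1 n, d r ω)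
    (t := ε / C) ε (div_nonneg hε hC0) (integrable_exp_mul_sum hd hb _ n)
  refine h.trans ?_
  refine (mul_le_mul_of_nonneg_left (integral_exp_mul_sum_le hc hd hb h0 _ n)
    (Real.exp_pos _).le).trans_eq ?_
  rw [← Real.exp_add, ← hC]
  congr 1
  rcases hC0.eq_or_lt with h | h
  · simp [← h]
  · field_simp
    ring

/-- Two-sided Azuma–Hoeffding inequality. -/
lemma measureReal_abs_sum_ge_le (hc : ∀ r, 1 ≤ r → 0 < c r)
    (hd : ∀ r, 1 ≤ r → StronglyMeasurable[F r] (d r))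
    (hb : ∀ r, 1 ≤ r → ∀ ω, |d r ω| ≤ c r)
    (h0 : ∀ r, 1 ≤ r → P[d r|F (r - 1)] =ᵐ[P] 0) (n : ℕ) {ε : ℝ} (hε : 0 ≤ ε) :
    P.real {ω | ε ≤ |∑ r ∈ Finset.Icc 1 n, d r ω|}
      ≤ 2 * Real.exp (-ε ^ 2 / (2 * ∑ r ∈ Finset.Icc 1 n, c r ^ 2)) := by
  have h1 := measureReal_sum_ge_le hc hd hb h0 n hε
  have h2 := measureReal_sum_ge_le (d := fun r => -d r) hc (fun r hr => (hd r hr).neg)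
    (fun r hr ω => by simpa using hb r hr ω)
    (fun r hr => (condExp_neg (d r) _).trans (by
      filter_upwards [h0 r hr] with ω h; simp [h])) n hε
  have hsub : {ω | ε ≤ |∑ r ∈ Finset.Icc 1 n, d r ω|} ⊆
      {ω | ε ≤ ∑ r ∈ Finset.Icc 1 n, d r ω} ∪ {ω | ε ≤ ∑ r ∈ Finset.Icc 1 n, (-d r) ω} := by
    intro ω hω
    simpa [le_abs] using hω
  linarith [(measureReal_mono hsub (μ := P)).trans (measureReal_union_le _ _)]

/-- Predictable bounded combinations of centred indicators have vanishing conditional mean. -/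
lemma condExp_sum_mul_indicator_sub {m : ℕ} {G : MeasurableSpace Ω} (hG : G ≤ mΩ)
    {x h : Ω → Fin m → ℝ} {a : Ω → Fin m} {K : ℝ} (ha : Measurable[mΩ] a)
    (hx : ∀ b, StronglyMeasurable[G] fun ω => x ω b)
    (hx1 : ∀ ω b, x ω b ∈ Set.Icc (0 : ℝ) 1)
    (hh : ∀ b, StronglyMeasurable[G] fun ω => h ω b) (hK : ∀ ω b, |h ω b| ≤ K)
    (hcond : ∀ b, P[(fun ω => if a ω = b then (1 : ℝ) else 0)|G] =ᵐ[P] fun ω => x ω b) :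
    P[(fun ω => ∑ b, h ω b * ((if a ω = b then (1 : ℝ) else 0) - x ω b))|G] =ᵐ[P] 0 := by
  have hindm : ∀ b, AEStronglyMeasurable[mΩ] (fun ω => if a ω = b then (1 : ℝ) else 0) P := fun b =>
    (Measurable.ite (ha (measurableSet_singleton b)) measurable_const
      measurable_const).aestronglyMeasurable
  have hind : ∀ b, Integrable (fun ω => if a ω = b then (1 : ℝ) else 0) P := fun b =>
    Integrable.of_bound (hindm b) 1 (ae_of_all _ fun ω => by split_ifs <;> simp)
  have hxi : ∀ b, Integrable (fun ω => x ω b) P := fun b =>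
    Integrable.of_bound ((hx b).mono hG).aestronglyMeasurable 1 (ae_of_all _ fun ω => by
      rw [Real.norm_eq_abs, abs_of_nonneg (hx1 ω b).1]; exact (hx1 ω b).2)
  have hint : ∀ b, Integrable
      (fun ω => h ω b * ((if a ω = b then (1 : ℝ) else 0) - x ω b)) P := fun b =>
    ((hind b).sub (hxi b)).bdd_mul ((hh b).mono hG).aestronglyMeasurable
      (ae_of_all _ fun ω => hK ω b)
  have hterm : ∀ b,
      P[(fun ω => h ω b * ((if a ω = b then (1 : ℝ) else 0) - x ω b))|G] =ᵐ[P] 0 := by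
    intro b
    have h1 := condExp_mul_of_stronglyMeasurable_left (hh b) (hint b) ((hind b).sub (hxi b))
    have h2 := condExp_sub (hind b) (hxi b) G
    rw [condExp_of_stronglyMeasurable hG (hx b) (hxi b)] at h2
    filter_upwards [h1, h2, hcond b] with ω h1 h2 h3
    have h4 : P[fun ω => (if a ω = b then (1 : ℝ) else 0) - x ω b|G] ω = 0 := by
      refine h2.trans ?_
      simp [h3]
    refine h1.trans ?_
    simp [h4]
  have hsum := condExp_finsetSum (s := Finset.univ) (fun b _ => hint b) G
  have hall := ae_all_iff.2 hterm
  have e : (fun ω => ∑ b, h ω b * ((if a ω = b then (1 : ℝ) else 0) - x ω b)) =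
      ∑ b, fun ω => h ω b * ((if a ω = b then (1 : ℝ) else 0) - x ω b) := by
    ext ω; simp
  rw [e]
  filter_upwards [hsum, hall] with ω h1 h2
  simp only [h1, Finset.sum_apply, h2, Pi.zero_apply, Finset.sum_const_zero]

end MartingaleDifferences

lemma tail_bound_le {m t : ℕ} (hm : 1 ≤ m) (ht : 1 ≤ t) {δ : ℝ} (hδ0 : 0 < δ) (hδ1 : δ < 1) :
    1 ≤ Real.log (Real.pi ^ 2 * (m : ℝ) * (t : ℝ) ^ 2 / (3 * δ)) ∧
    ((m : ℝ) + 1) *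
        (2 * Real.exp (-2 * Real.log (Real.pi ^ 2 * (m : ℝ) * (t : ℝ) ^ 2 / (3 * δ)) ^ 2))
      ≤ 6 * δ / Real.pi ^ 2 * (1 / (t : ℝ) ^ 2) := by
  have hm' : (1 : ℝ) ≤ m := by exact_mod_cast hm
  have ht' : (1 : ℝ) ≤ t := by exact_mod_cast ht
  have hpi := Real.pi_gt_three
  set A : ℝ := Real.pi ^ 2 * (m : ℝ) * (t : ℝ) ^ 2 / (3 * δ) with hA
  have hA3 : 3 ≤ A := by
    rw [hA, le_div_iff₀ (by positivity)]
    have h9 : 9 ≤ Real.pi ^ 2 := by nlinarith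
    have ht2 : (1 : ℝ) ≤ (t : ℝ) ^ 2 := one_le_pow₀ ht'
    calc 3 * (3 * δ) ≤ 9 * 1 * 1 := by linarith
      _ ≤ Real.pi ^ 2 * m * (t : ℝ) ^ 2 := by gcongr
  have hA0 : 0 < A := by linarith
  have hL : 1 ≤ Real.log A := by
    rw [Real.le_log_iff_exp_le hA0]
    linarith [Real.exp_one_lt_d9]
  refine ⟨hL, ?_⟩
  have hexp : Real.exp (-2 * Real.log A ^ 2) ≤ A⁻¹ ^ 2 := by
    have : A⁻¹ ^ 2 = Real.exp (-2 * Real.log A) := by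
      rw [show -2 * Real.log A = -Real.log A + -Real.log A by ring, Real.exp_add, Real.exp_neg,
        Real.exp_log hA0, sq]
    rw [this]
    exact Real.exp_le_exp.2 (by nlinarith)
  have hR : 6 * δ / Real.pi ^ 2 * (1 / (t : ℝ) ^ 2) = 2 * m * A⁻¹ := by
    rw [hA]; field_simp; ring
  have hAi : 0 < A⁻¹ := inv_pos.2 hA0
  have hA2 : A⁻¹ ≤ 1 / 2 := by
    rw [inv_le_comm₀ hA0 (by norm_num)]; linarith
  rw [hR]
  calc ((m : ℝ) + 1) * (2 * Real.exp (-2 * Real.log A ^ 2))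
      ≤ (m + m) * (2 * A⁻¹ ^ 2) := by gcongr
    _ = 4 * m * A⁻¹ * A⁻¹ := by ring
    _ ≤ 4 * m * A⁻¹ * (1 / 2) := by gcongr
    _ = 2 * m * A⁻¹ := by ring

/-- importance-weighted regret estimation.  A single learner with `m` actions plays
in epochs `t = 1,2,…` of lengths `B t`; rounds are indexed globally (round `r` belongs to epoch
`ep r`, where `Tcum t = ∑_{k≤t} B k`).  At the start of epoch `t` the learner fixes a strategy
`X t` (measurable w.r.t. the history `F (Tcum (t−1))`), with `X t ω ∈ Δ^m` and
`X t ω b ≥ 1/(m·t)`; the round-`r` adversarial utility `u r` is history-measurable, valued in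
`[0,1]`; the action `a r` is drawn from `X (ep r)` conditionally on the history (stated via the
conditional expectation of indicators).  `Utilde` are the importance-weighted epoch aggregates
and `Utrue` the true ones.  Then with probability at least `1 − δ`, simultaneously for every
epoch `t ≥ 1`, `|Reg^{T_t} − R̃eg^{T_t}| ≤ 4m√(∑_{k≤t} k²B_k)·log(π²mt²/(3δ))`. -/
theorem stmt16
    (m : ℕ) (hm : 1 ≤ m) (δ : ℝ) (hδ0 : 0 < δ) (hδ1 : δ < 1)
    (B : ℕ → ℕ) (hB : ∀ t, 1 ≤ t → 1 ≤ B t)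
    (Tcum : ℕ → ℕ) (hTcum : ∀ t, Tcum t = ∑ k ∈ Finset.Icc 1 t, B k)
    (ep : ℕ → ℕ) (hep : ∀ r, 1 ≤ r → 1 ≤ ep r ∧ Tcum (ep r - 1) < r ∧ r ≤ Tcum (ep r))
    {Ω : Type*} {mΩ : MeasurableSpace Ω} (P : Measure Ω) [IsProbabilityMeasure P]
    (F : Filtration ℕ mΩ)
    -- the learner's strategy in each epoch
    (X : ℕ → Ω → Fin m → ℝ)
    (hXmeas : ∀ t, 1 ≤ t → ∀ b, StronglyMeasurable[F (Tcum (t - 1))] (fun ω => X t ω b))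
    (hXsimplex : ∀ t, 1 ≤ t → ∀ ω, X t ω ∈ stdSimplex ℝ (Fin m))
    (hXlb : ∀ t : ℕ, 1 ≤ t → ∀ ω b, 1 / ((m : ℝ) * (t : ℝ)) ≤ X t ω b)
    -- the adversarial utility vectors, history-measurable and `[0,1]`-valued
    (u : ℕ → Ω → Fin m → ℝ)
    (humeas : ∀ r, 1 ≤ r → ∀ b, StronglyMeasurable[F (r - 1)] (fun ω => u r ω b))
    (hurange : ∀ r ω b, u r ω b ∈ Set.Icc (0 : ℝ) 1)
    -- the sampled actions: measurable, with conditional law given the history equal to `X (ep r)`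
    (a : ℕ → Ω → Fin m)
    (hameas : ∀ r, 1 ≤ r → Measurable[F r] (a r))
    (hcond : ∀ r, 1 ≤ r → ∀ b,
      P[(fun ω => if a r ω = b then (1 : ℝ) else 0)|F (r - 1)]
        =ᵐ[P] fun ω => X (ep r) ω b)
    -- epoch aggregates of importance-weighted estimates and of true utilities
    (Utilde Utrue : ℕ → Ω → Fin m → ℝ)
    (hUtilde : ∀ t ω b, Utilde t ω b =
      ∑ r ∈ Finset.Icc (Tcum (t - 1) + 1) (Tcum t),
        (if b = a r ω then u r ω (a r ω) else 0) / X t ω b)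
    (hUtrue : ∀ t ω b, Utrue t ω b =
      ∑ r ∈ Finset.Icc (Tcum (t - 1) + 1) (Tcum t), u r ω b) :
    ENNReal.ofReal (1 - δ) ≤
      P {ω | ∀ t, 1 ≤ t →
        |((⨆ y : stdSimplex ℝ (Fin m),
              ∑ k ∈ Finset.Icc 1 t, ∑ b, Utrue k ω b * (y : Fin m → ℝ) b)
            - ∑ k ∈ Finset.Icc 1 t, ∑ b, Utrue k ω b * X k ω b)
          - ((⨆ y : stdSimplex ℝ (Fin m),
              ∑ k ∈ Finset.Icc 1 t, ∑ b, Utilde k ω b * (y : Fin m → ℝ) b)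
            - ∑ k ∈ Finset.Icc 1 t, ∑ b, Utilde k ω b * X k ω b)| ≤
          4 * (m : ℝ) * Real.sqrt (∑ k ∈ Finset.Icc 1 t, (k : ℝ) ^ 2 * (B k : ℝ))
            * Real.log (Real.pi ^ 2 * (m : ℝ) * (t : ℝ) ^ 2 / (3 * δ))} := by
  have hmR : (1 : ℝ) ≤ m := by exact_mod_cast hm
  have hTmono : Monotone Tcum := fun p q hpq => by
    rw [hTcum, hTcum]
    exact Finset.sum_le_sum_of_subset (Finset.Icc_subset_Icc_right hpq)
  have hep_eq : ∀ t r, 1 ≤ t → r ∈ Finset.Icc (Tcum (t - 1) + 1) (Tcum t) → ep r = t := by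
    intro t r ht hr
    rw [Finset.mem_Icc] at hr
    obtain ⟨h1, h2, h3⟩ := hep r (by omega)
    by_contra hne
    rcases Nat.lt_or_gt_of_ne hne with h | h
    · have := hTmono (show ep r ≤ t - 1 by omega); omega
    · have := hTmono (show t ≤ ep r - 1 by omega); omega
  have hblock : ∀ (g : ℕ → ℕ → ℝ) (t : ℕ),
      ∑ k ∈ Finset.Icc 1 t, ∑ r ∈ Finset.Icc (Tcum (k - 1) + 1) (Tcum k), g k r
        = ∑ r ∈ Finset.Icc 1 (Tcum t), g (ep r) r := by
    intro g t
    rw [← sum_Icc_blocks hTcum]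
    refine Finset.sum_congr rfl fun k hk => Finset.sum_congr rfl fun r hr => ?_
    rw [hep_eq k r (Finset.mem_Icc.1 hk).1 hr]
  have hcard : ∀ t, 1 ≤ t → (Finset.Icc (Tcum (t - 1) + 1) (Tcum t)).card = B t := by
    intro t ht
    obtain ⟨s, rfl⟩ : ∃ s, t = s + 1 := ⟨t - 1, by omega⟩
    have : Tcum (s + 1) = Tcum s + B (s + 1) := by
      rw [hTcum, hTcum, Finset.sum_Icc_succ_top (by omega)]
    rw [Nat.card_Icc, Nat.add_sub_cancel]
    omega
  have hX01 : ∀ t, 1 ≤ t → ∀ ω b, X t ω b ∈ Set.Icc (0 : ℝ) 1 := fun t ht ω b =>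
    mem_Icc_of_mem_stdSimplex (hXsimplex t ht ω) b
  have hXpos : ∀ t : ℕ, 1 ≤ t → ∀ ω b, 0 < X t ω b := fun t ht ω b =>
    lt_of_lt_of_le (by have : 0 < t := ht; positivity) (hXlb t ht ω b)
  have hXinv : ∀ t : ℕ, 1 ≤ t → ∀ ω b, 1 / X t ω b ≤ m * t := by
    intro t ht ω b
    have h := one_div_le_one_div_of_le (by have : 0 < t := ht; positivity) (hXlb t ht ω b)
    rwa [one_div_one_div] at h
  let c : ℕ → ℝ := fun r => m * ep r
  have hc1 : ∀ r, 1 ≤ r → 1 ≤ c r := fun r hr => by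
    have : (1 : ℝ) ≤ ep r := by exact_mod_cast (hep r hr).1
    exact one_le_mul_of_one_le_of_one_le hmR this
  have hratio : ∀ r, 1 ≤ r → ∀ ω b, u r ω b / X (ep r) ω b ∈ Set.Icc 0 (c r) := by
    intro r hr ω b
    have he := (hep r hr).1
    have hu := hurange r ω b
    refine ⟨div_nonneg hu.1 (hXpos _ he ω b).le, ?_⟩
    refine le_trans ?_ (hXinv _ he ω b)
    exact div_le_div_of_nonneg_right hu.2 (hXpos _ he ω b).le
  let h : Option (Fin m) → ℕ → Ω → Fin m → ℝ := fun i r ω b =>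
    i.elim (u r ω b) fun b₀ => if b = b₀ then u r ω b / X (ep r) ω b else 0
  let d : Option (Fin m) → ℕ → Ω → ℝ := fun i r ω =>
    ∑ b, h i r ω b * ((if a r ω = b then (1 : ℝ) else 0) - X (ep r) ω b)
  have hd_none : ∀ r ω, d none r ω = u r ω (a r ω) - ∑ b, u r ω b * X (ep r) ω b := by
    intro r ω
    simp [d, h, mul_sub, Finset.sum_sub_distrib]
  have hd_some : ∀ b r, 1 ≤ r → ∀ ω, d (some b) r ω =
      (if b = a r ω then u r ω (a r ω) else 0) / X (ep r) ω b - u r ω b := by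
    intro b r hr ω
    have := (hXpos _ (hep r hr).1 ω b).ne'
    simp only [d, h, Option.elim_some, ite_mul, zero_mul, Finset.sum_ite_eq', Finset.mem_univ,
      if_true]
    by_cases hab : a r ω = b
    · subst hab; simp; field_simp
    · simp [hab, Ne.symm hab]; field_simp
  have hXm : ∀ r, 1 ≤ r → ∀ b, StronglyMeasurable[F (r - 1)] fun ω => X (ep r) ω b := by
    intro r hr b
    obtain ⟨h1, h2, -⟩ := hep r hr
    exact (hXmeas _ h1 b).mono (F.mono (by omega))
  have hhm : ∀ i r, 1 ≤ r → ∀ b, StronglyMeasurable[F (r - 1)] fun ω => h i r ω b := by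
    intro i r hr b
    cases i with
    | none => exact humeas r hr b
    | some b₀ =>
      by_cases hb : b = b₀
      · simp only [h, Option.elim_some, hb, if_true]
        exact ((humeas r hr b₀).measurable.div (hXm r hr b₀).measurable).stronglyMeasurable
      · simp only [h, Option.elim_some, hb, if_false]
        exact stronglyMeasurable_const
  have hhb : ∀ i r, 1 ≤ r → ∀ ω b, |h i r ω b| ≤ c r := by
    intro i r hr ω b
    have h1 := hc1 r hr
    cases i with
    | none =>
      have hu := hurange r ω b
      simp only [h, Option.elim_none, abs_of_nonneg hu.1]
      linarith [hu.2]
    | some b₀ =>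
      have hq := hratio r hr ω b
      simp only [h, Option.elim_some]
      split_ifs
      · rw [abs_of_nonneg hq.1]; exact hq.2
      · simp; linarith
  have hdm : ∀ i r, 1 ≤ r → StronglyMeasurable[F r] (d i r) := by
    intro i r hr
    have hle : F (r - 1) ≤ F r := F.mono (Nat.sub_le _ _)
    refine Finset.stronglyMeasurable_fun_sum _ fun b _ => ((hhm i r hr b).mono hle).mul
      (StronglyMeasurable.sub ?_ ((hXm r hr b).mono hle))
    exact (Measurable.ite (hameas r hr (measurableSet_singleton b)) measurable_const
      measurable_const).stronglyMeasurable
  have hdb : ∀ i r, 1 ≤ r → ∀ ω, |d i r ω| ≤ c r := by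
    intro i r hr ω
    have h1 := hc1 r hr
    have he := (hep r hr).1
    cases i with
    | none =>
      have hs0 : 0 ≤ ∑ b, u r ω b * X (ep r) ω b := Finset.sum_nonneg fun b _ =>
        mul_nonneg (hurange r ω b).1 (hX01 _ he ω b).1
      have hs1 : ∑ b, u r ω b * X (ep r) ω b ≤ 1 := by
        rw [← (hXsimplex _ he ω).2]
        exact Finset.sum_le_sum fun b _ =>
          mul_le_of_le_one_left (hX01 _ he ω b).1 (hurange r ω b).2
      have hu := hurange r ω (a r ω)
      rw [hd_none, abs_le]
      constructor <;> linarith [hu.1, hu.2]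
    | some b =>
      have hq := hratio r hr ω b
      have hu := hurange r ω b
      rw [hd_some b r hr, abs_le]
      split_ifs with hab
      · rw [← hab]
        constructor <;> linarith [hu.1, hu.2, hq.1, hq.2]
      · rw [zero_div]
        constructor <;> linarith [hu.1, hu.2]
  have hd0 : ∀ i r, 1 ≤ r → P[d i r|F (r - 1)] =ᵐ[P] 0 := fun i r hr =>
    condExp_sum_mul_indicator_sub (F.le _) ((hameas r hr).mono (F.le r) le_rfl) (hXm r hr)
      (hX01 _ (hep r hr).1) (hhm i r hr) (hhb i r hr) (hcond r hr)
  let V : ℕ → ℝ := fun t => ∑ k ∈ Finset.Icc 1 t, (k : ℝ) ^ 2 * (B k : ℝ)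
  let L : ℕ → ℝ := fun t => Real.log (Real.pi ^ 2 * (m : ℝ) * (t : ℝ) ^ 2 / (3 * δ))
  let ε : ℕ → ℝ := fun t => 2 * m * Real.sqrt (V t) * L t
  have hVc : ∀ t, ∑ r ∈ Finset.Icc 1 (Tcum t), c r ^ 2 = (m : ℝ) ^ 2 * V t := by
    intro t
    rw [← hblock (fun k _ => ((m : ℝ) * k) ^ 2), Finset.mul_sum]
    refine Finset.sum_congr rfl fun k hk => ?_
    rw [Finset.sum_const, hcard k (Finset.mem_Icc.1 hk).1, nsmul_eq_mul]
    ring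
  have hVpos : ∀ t, 1 ≤ t → 0 < V t := fun t ht =>
    Finset.sum_pos (fun k hk => by
      have hk1 : 0 < k := (Finset.mem_Icc.1 hk).1
      have : 0 < B k := hB k hk1
      positivity) ⟨1, Finset.mem_Icc.2 ⟨le_rfl, ht⟩⟩
  let Bad : ℕ → Set Ω := fun t =>
    {ω | 1 ≤ t ∧ ∃ i, ε t ≤ |∑ r ∈ Finset.Icc 1 (Tcum t), d i r ω|}
  have hBad : ∀ t, P (Bad t) ≤ ENNReal.ofReal (6 * δ / Real.pi ^ 2 * (1 / (t : ℝ) ^ 2)) := by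
    intro t
    by_cases ht : 1 ≤ t
    swap
    · have : Bad t = ∅ := by ext ω; simp [Bad, ht]
      simp [this]
    obtain ⟨hL, htail⟩ := tail_bound_le hm ht hδ0 hδ1
    have hε : 0 ≤ ε t := by
      have : 0 ≤ L t := zero_le_one.trans hL
      positivity
    have hexp : -ε t ^ 2 / (2 * ∑ r ∈ Finset.Icc 1 (Tcum t), c r ^ 2) = -2 * L t ^ 2 := by
      have hV := hVpos t ht
      rw [hVc, show ε t ^ 2 = 4 * m ^ 2 * V t * L t ^ 2 by
        simp only [ε, mul_pow, Real.sq_sqrt hV.le]; ring]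
      field_simp
      ring
    have hsub : Bad t ⊆ ⋃ i, {ω | ε t ≤ |∑ r ∈ Finset.Icc 1 (Tcum t), d i r ω|} := by
      rintro ω ⟨-, i, hi⟩
      exact Set.mem_iUnion.2 ⟨i, hi⟩
    rw [← ofReal_measureReal]
    refine ENNReal.ofReal_le_ofReal (le_trans ?_ htail)
    calc P.real (Bad t)
        ≤ ∑ i, P.real {ω | ε t ≤ |∑ r ∈ Finset.Icc 1 (Tcum t), d i r ω|} :=
          (measureReal_mono hsub).trans (measureReal_iUnion_fintype_le _)
      _ ≤ ∑ _i : Option (Fin m), 2 * Real.exp (-2 * L t ^ 2) := Finset.sum_le_sum fun i _ => by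
          rw [← hexp]
          exact measureReal_abs_sum_ge_le (fun r hr => zero_lt_one.trans_le (hc1 r hr)) (hdm i)
            (hdb i) (hd0 i) _ hε
      _ = ((m : ℝ) + 1) * (2 * Real.exp (-2 * L t ^ 2)) := by simp
  have hBadU : P (⋃ t, Bad t) ≤ ENNReal.ofReal δ := by
    have hs := hasSum_zeta_two.mul_left (6 * δ / Real.pi ^ 2)
    have hval : 6 * δ / Real.pi ^ 2 * (Real.pi ^ 2 / 6) = δ := by field_simp
    rw [hval] at hs
    calc P (⋃ t, Bad t) ≤ ∑' t, P (Bad t) := measure_iUnion_le _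
      _ ≤ ∑' t : ℕ, ENNReal.ofReal (6 * δ / Real.pi ^ 2 * (1 / (t : ℝ) ^ 2)) :=
          ENNReal.tsum_le_tsum hBad
      _ = ENNReal.ofReal δ := by
          rw [← ENNReal.ofReal_tsum_of_nonneg (fun t => by positivity) hs.summable, hs.tsum_eq]
  have hone : 1 ≤ P (⋃ t, Bad t)ᶜ + P (⋃ t, Bad t) := by
    rw [← measure_univ (μ := P), ← Set.compl_union_self (⋃ t, Bad t)]
    exact measure_union_le _ _
  have hgood : ENNReal.ofReal (1 - δ) ≤ P (⋃ t, Bad t)ᶜ := by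
    rw [ENNReal.ofReal_sub _ hδ0.le, ENNReal.ofReal_one]
    exact tsub_le_iff_right.2 (hone.trans (by gcongr))
  refine hgood.trans (measure_mono fun ω hω t ht => ?_)
  have hD : ∀ i, |∑ r ∈ Finset.Icc 1 (Tcum t), d i r ω| ≤ ε t := by
    intro i
    by_contra hi
    exact hω (Set.mem_iUnion.2 ⟨t, ht, i, (not_le.1 hi).le⟩)
  have hswap : ∀ (U : ℕ → Ω → Fin m → ℝ) (y : Fin m → ℝ),
      ∑ k ∈ Finset.Icc 1 t, ∑ b, U k ω b * y b = ∑ b, (∑ k ∈ Finset.Icc 1 t, U k ω b) * y b := by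
    intro U y
    rw [Finset.sum_comm]
    simp only [Finset.sum_mul]
  have hsup : |(⨆ y : stdSimplex ℝ (Fin m),
        ∑ k ∈ Finset.Icc 1 t, ∑ b, Utrue k ω b * (y : Fin m → ℝ) b)
      - ⨆ y : stdSimplex ℝ (Fin m),
        ∑ k ∈ Finset.Icc 1 t, ∑ b, Utilde k ω b * (y : Fin m → ℝ) b| ≤ ε t := by
    simp only [hswap]
    refine abs_iSup_stdSimplex_sub_le hm fun b => ?_
    rw [abs_sub_comm]
    convert hD (some b) using 2
    simp only [hUtilde, hUtrue]
    rw [hblock (fun k r => (if b = a r ω then u r ω (a r ω) else 0) / X k ω b),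
      hblock (fun _ r => u r ω b), ← Finset.sum_sub_distrib]
    exact Finset.sum_congr rfl fun r hr => (hd_some b r (Finset.mem_Icc.1 hr).1 ω).symm
  have hplay : |∑ k ∈ Finset.Icc 1 t, ∑ b, Utilde k ω b * X k ω b
      - ∑ k ∈ Finset.Icc 1 t, ∑ b, Utrue k ω b * X k ω b| ≤ ε t := by
    convert hD none using 2
    have e : ∀ (U : ℕ → Ω → Fin m → ℝ) (g : ℕ → ℕ → Fin m → ℝ),
        (∀ k b, U k ω b = ∑ r ∈ Finset.Icc (Tcum (k - 1) + 1) (Tcum k), g k r b) →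
        ∑ k ∈ Finset.Icc 1 t, ∑ b, U k ω b * X k ω b
          = ∑ r ∈ Finset.Icc 1 (Tcum t), ∑ b, g (ep r) r b * X (ep r) ω b := by
      intro U g hU
      rw [← hblock (fun k r => ∑ b, g k r b * X k ω b)]
      refine Finset.sum_congr rfl fun k _ => ?_
      rw [Finset.sum_comm]
      simp only [hU, Finset.sum_mul]
    rw [e Utilde _ fun k b => hUtilde k ω b, e Utrue _ fun k b => hUtrue k ω b,
      ← Finset.sum_sub_distrib]
    refine Finset.sum_congr rfl fun r hr => ?_
    rw [hd_none]
    congr 1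
    have hX := fun b => (hXpos _ (hep r (Finset.mem_Icc.1 hr).1).1 ω b).ne'
    simp [div_mul_cancel₀ _ (hX _)]
  have hε2 : 4 * (m : ℝ) * Real.sqrt (V t) * L t = ε t + ε t := by
    simp only [ε]; ring
  refine le_trans ?_ hε2.ge
  rw [abs_le] at hsup hplay ⊢
  constructor <;> linarith [hsup.1, hsup.2, hplay.1, hplay.2]
end
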